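/- arXiv:2601.20743 — 4 statements merged into one kernel-verified Lean document; each statement's English description precedes it below -/
import Mathlib

section
/- Let t ≥ 2 be an integer and let (a(n)) be a sequence of nonnegative integers, nonzero for infinitely many n, with support n_1 < n_2 < ⋯. Suppose log(max(n_k, max_{m ≤ n_k} a(m))) = O(log n_k) as k → ∞, and suppose there is a positive integer ℓ with limsup_k n_k / (k^ℓ log n_k) = ∞. Then ∑_{n≥1} a(n)/t^n is either transcendental or algebraic of degree at least ℓ + 1 over ℚ. -/
open Filter Asymptotics Polynomial

/-- Averaging over the gaps of `A`: if `A'` is sparse in `[0, N)`, then it is sparse in one of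
the gaps of `A`. -/
theorem exists_sparse_gap (A A' : Set ℕ) [DecidablePred (· ∈ A')] (h0 : 0 ∈ A) (lam N : ℕ)
    (hN : lam * ((Finset.range N).filter (· ∈ A')).card < N) :
    ∃ i j, i ∈ A ∧ i < j ∧ j ≤ N ∧ (∀ n, i < n → n < j → n ∉ A) ∧
      lam * ((Finset.Ico i j).filter (· ∈ A')).card < j - i := by
  classical
  by_contra! hcon
  have key : ∀ x, x ≤ N → (x ∈ A ∨ x = N) →
      x ≤ lam * ((Finset.range x).filter (· ∈ A')).card := by
    intro x
    induction x using Nat.strong_induction_on with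
    | _ x ih =>
      intro hxN hx
      rcases Nat.eq_zero_or_pos x with rfl | hxpos
      · simp
      have hne : ((Finset.range x).filter (· ∈ A)).Nonempty := ⟨0, by simp [hxpos, h0]⟩
      set i := ((Finset.range x).filter (· ∈ A)).max' hne with hi
      have himem := Finset.max'_mem _ hne
      rw [← hi, Finset.mem_filter, Finset.mem_range] at himem
      have hgap : ∀ n, i < n → n < x → n ∉ A := by
        intro n hin hnx hnA
        have := Finset.le_max' ((Finset.range x).filter (· ∈ A)) n (by simp [hnx, hnA])
        omega
      have h1 := ih i himem.1 (by omega) (Or.inl himem.2)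
      have h2 := hcon i x himem.2 himem.1 hxN hgap
      have hcard : ((Finset.range x).filter (· ∈ A')).card =
          ((Finset.range i).filter (· ∈ A')).card +
            ((Finset.Ico i x).filter (· ∈ A')).card := by
        rw [← Finset.card_union_of_disjoint, ← Finset.filter_union]
        · congr 2
          ext n
          simp only [Finset.mem_union, Finset.mem_range, Finset.mem_Ico]
          omega
        · rw [Finset.disjoint_left]
          simp only [Finset.mem_filter, Finset.mem_range, Finset.mem_Ico]
          omega
      rw [hcard, mul_add]
      omega
  have := key N le_rfl (Or.inr rfl)
  omega

/-- A set meeting every window `(R, R + K]` with `i ≤ R < i + s` and containing `i` has more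
than `c` elements in `[i, i + s]` as soon as `K * c < s`. -/
theorem lt_card_of_forall_window (A' : Set ℕ) [DecidablePred (· ∈ A')] {K c s i j : ℕ}
    (hi : i ∈ A') (hs : K * c < s) (hj : i + s < j)
    (hwin : ∀ R, i ≤ R → R < i + s → ∃ n ∈ A', R < n ∧ n ≤ R + K) :
    c < ((Finset.Ico i j).filter (· ∈ A')).card := by
  have hwin' : ∀ m, m < c → ∃ n ∈ A', i + K * m < n ∧ n ≤ i + K * m + K := by
    intro m hm
    have : K * m ≤ K * c := Nat.mul_le_mul_left _ hm.le
    exact hwin _ (by omega) (by omega)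
  choose! f hfA hf1 hf2 using hwin'
  have hsub : insert i ((Finset.range c).image f) ⊆ (Finset.Ico i j).filter (· ∈ A') := by
    intro n hn
    rw [Finset.mem_insert, Finset.mem_image] at hn
    rw [Finset.mem_filter, Finset.mem_Ico]
    rcases hn with rfl | ⟨m, hm, rfl⟩
    · exact ⟨by omega, hi⟩
    · rw [Finset.mem_range] at hm
      have h1 := hf1 m hm
      have h2 := hf2 m hm
      have : K * (m + 1) ≤ K * c := Nat.mul_le_mul_left _ hm
      rw [Nat.mul_succ] at this
      exact ⟨by omega, hfA m hm⟩
  have hinj : Set.InjOn f (Finset.range c : Set ℕ) := by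
    have hlt : ∀ m m', m < c → m' < c → m < m' → f m < f m' := by
      intro m m' hm hm' hmm
      have h2 := hf2 m hm
      have h1 := hf1 m' hm'
      have : K * (m + 1) ≤ K * m' := Nat.mul_le_mul_left _ hmm
      rw [Nat.mul_succ] at this
      omega
    intro m hm m' hm' hmm
    rw [Finset.mem_coe, Finset.mem_range] at hm hm'
    rcases lt_trichotomy m m' with h | h | h
    · exact absurd hmm (hlt m m' hm hm' h).ne
    · exact h
    · exact absurd hmm (hlt m' m hm' hm h).ne'
  have hnot : i ∉ (Finset.range c).image f := by
    rw [Finset.mem_image]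
    rintro ⟨m, hm, hmi⟩
    have := hf1 m (Finset.mem_range.1 hm)
    omega
  have := Finset.card_le_card hsub
  rw [Finset.card_insert_of_notMem hnot, Finset.card_image_of_injOn hinj,
    Finset.card_range] at this
  omega

/-- A lower bound for the size of `A'` from a sequence `T` which is nonnegative before windows
avoiding `A`, vanishes before windows avoiding `A'`, and whose positivity propagates downwards
in the gaps of `A`. -/
theorem le_mul_card_of_carries (A A' S : Set ℕ) [DecidablePred (· ∈ A')] (T : ℕ → ℤ)
    {K E N : ℕ} (hK : 1 ≤ K) (h0 : 0 ∈ A) (hAA' : A ⊆ A')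
    (hadd : ∀ i ∈ A, ∀ s ∈ S, i + s ∈ A')
    (hgrow : ∀ x, ∃ s ∈ S, x < s ∧ s ≤ E * (x + 1))
    (hnonneg : ∀ R ≤ N, (∀ n, R < n → n ≤ R + K → n ∉ A) → 0 ≤ T R)
    (hzero : ∀ R ≤ N, (∀ n, R < n → n ≤ R + K → n ∉ A') → T R = 0)
    (hstep : ∀ R, R + 1 ∉ A → 0 < T (R + 1) → 0 < T R)
    (hstart : ∀ R, R + 1 ∉ A → R + 1 ∈ A' → 0 ≤ T (R + 1) → 0 < T R) :
    N ≤ (2 * E + 1) * K * ((Finset.range N).filter (· ∈ A')).card := by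
  by_contra! hN
  obtain ⟨i, j, hiA, hij, hjN, hgap, hlen⟩ := exists_sparse_gap A A' h0 _ N hN
  set c := ((Finset.Ico i j).filter (· ∈ A')).card with hc
  have hcpos : 1 ≤ c := Finset.card_pos.2 ⟨i, by simp [hij, hAA' hiA]⟩
  obtain ⟨s, hsS, hsgt, hsle⟩ := hgrow (K * c)
  have hKc : 1 ≤ K * c := Nat.mul_pos hK hcpos
  have hsK : i + s + K < j := by
    have h1 : E * (K * c + 1) ≤ E * (2 * (K * c)) := Nat.mul_le_mul_left _ (by omega)
    have h2 : K ≤ K * c := Nat.le_mul_of_pos_right _ hcpos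
    have h3 : (2 * E + 1) * K * c = E * (2 * (K * c)) + K * c := by ring
    omega
  have hTs : 0 ≤ T (i + s) :=
    hnonneg _ (by omega) fun n hn hn' => hgap n (by omega) (by omega)
  have hpos : ∀ m, m < s → 0 < T (i + s - (m + 1)) := by
    intro m
    induction m with
    | zero =>
      intro hm
      have he : i + s - (0 + 1) + 1 = i + s := by omega
      apply hstart
      · rw [he]; exact hgap _ (by omega) (by omega)
      · rw [he]; exact hadd i hiA s hsS
      · rwa [he]
    | succ m ih =>
      intro hm
      have he : i + s - (m + 1 + 1) + 1 = i + s - (m + 1) := by omega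
      apply hstep
      · rw [he]; exact hgap _ (by omega) (by omega)
      · rw [he]; exact ih (by omega)
  refine absurd (lt_card_of_forall_window A' (hAA' hiA) hsgt (by omega : i + s < j) ?_)
    (lt_irrefl c)
  intro R hiR hRs
  by_contra! hno
  have h1 := hpos (i + s - R - 1) (by omega)
  rw [show i + s - (i + s - R - 1 + 1) = R by omega,
    hzero R (by omega) fun n hn hn' hnA => absurd (hno n hnA hn) (by omega)] at h1
  exact lt_irrefl _ h1

theorem summable_mul_inv_pow {t : ℕ} (ht : 2 ≤ t) {M Q : ℕ} {f : ℕ → ℝ}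
    (hf : ∀ n, |f n| ≤ M * (n + 1 : ℝ) ^ Q) : Summable fun n => f n * (t : ℝ)⁻¹ ^ n := by
  have ht0 : (0 : ℝ) < t := by positivity
  have hx : ‖(t : ℝ)⁻¹‖ < 1 := by
    rw [norm_inv, RCLike.norm_natCast]
    exact inv_lt_one_of_one_lt₀ (by exact_mod_cast ht)
  have h : Summable fun n : ℕ => ((n + 1 : ℕ) : ℝ) ^ Q * (t : ℝ)⁻¹ ^ (n + 1) :=
    (summable_nat_add_iff (f := fun n : ℕ => (n : ℝ) ^ Q * (t : ℝ)⁻¹ ^ n) 1).2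
      (summable_pow_mul_geometric_of_norm_lt_one Q hx)
  refine Summable.of_norm_bounded (h.mul_left (M * t : ℝ)) fun n => ?_
  rw [norm_mul, norm_pow, norm_inv, RCLike.norm_natCast, Real.norm_eq_abs]
  have e : (M * t : ℝ) * (((n + 1 : ℕ) : ℝ) ^ Q * (t : ℝ)⁻¹ ^ (n + 1)) =
      M * (n + 1 : ℝ) ^ Q * (t : ℝ)⁻¹ ^ n := by
    push_cast; rw [pow_succ]; field_simp
  rw [e]
  gcongr
  exact hf n

theorem exists_tail_bound {t : ℕ} (ht : 2 ≤ t) (M Q : ℕ) :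
    ∃ C : ℕ, ∀ f : ℕ → ℝ, (∀ n, |f n| ≤ M * (n + 1 : ℝ) ^ Q) → ∀ s : ℕ,
      |∑' m, f (m + s) * (t : ℝ)⁻¹ ^ (m + s)| ≤ C * (s + 1 : ℝ) ^ Q * (t : ℝ)⁻¹ ^ s := by
  have ht0 : (0 : ℝ) < t := by positivity
  have hg : Summable fun n : ℕ => (M * (n + 1 : ℝ) ^ Q) * (t : ℝ)⁻¹ ^ n :=
    summable_mul_inv_pow (M := M) (Q := Q) ht fun n => (abs_of_nonneg (by positivity)).le
  obtain ⟨C, hC⟩ := exists_nat_ge (∑' n : ℕ, (M * (n + 1 : ℝ) ^ Q) * (t : ℝ)⁻¹ ^ n)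
  refine ⟨C, fun f hf s => ?_⟩
  have hle : ∀ m : ℕ, ‖f (m + s) * (t : ℝ)⁻¹ ^ (m + s)‖ ≤
      ((s + 1 : ℝ) ^ Q * (t : ℝ)⁻¹ ^ s) * ((M * (m + 1 : ℝ) ^ Q) * (t : ℝ)⁻¹ ^ m) := by
    intro m
    rw [norm_mul, norm_pow, norm_inv, RCLike.norm_natCast, Real.norm_eq_abs]
    have h1 : ((m + s : ℕ) + 1 : ℝ) ^ Q ≤ ((s + 1 : ℝ) * (m + 1)) ^ Q := by
      gcongr
      push_cast
      nlinarith [(Nat.cast_nonneg m : (0 : ℝ) ≤ m), (Nat.cast_nonneg s : (0 : ℝ) ≤ s),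
        mul_nonneg (Nat.cast_nonneg m : (0 : ℝ) ≤ m) (Nat.cast_nonneg s : (0 : ℝ) ≤ s)]
    calc |f (m + s)| * (t : ℝ)⁻¹ ^ (m + s)
        ≤ (M * ((s + 1 : ℝ) * (m + 1)) ^ Q) * (t : ℝ)⁻¹ ^ (m + s) := by
          gcongr
          exact (hf _).trans (by gcongr)
      _ = _ := by rw [mul_pow, pow_add]; ring
  have hb := tsum_of_norm_bounded (hg.mul_left ((s + 1 : ℝ) ^ Q * (t : ℝ)⁻¹ ^ s)).hasSum hle
  rw [tsum_mul_left, Real.norm_eq_abs] at hb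
  calc _ ≤ _ := hb
    _ ≤ ((s + 1 : ℝ) ^ Q * (t : ℝ)⁻¹ ^ s) * C := by gcongr
    _ = _ := by ring

/-- The integers `T R = -∑_{n ≤ R} e n t ^ (R - n)`. If `∑ e n t⁻ⁿ = 0`, then `T R` is the
rescaled tail `∑_{n > R} e n t ^ (R - n)`. -/
def carry (t : ℕ) (e : ℕ → ℤ) : ℕ → ℤ
  | 0 => -e 0
  | R + 1 => t * carry t e R - e (R + 1)

theorem carry_neg (t : ℕ) (e : ℕ → ℤ) (R : ℕ) : carry t (-e) R = -carry t e R := by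
  induction R with
  | zero => simp [carry]
  | succ R ih => simp only [carry, ih, Pi.neg_apply]; ring

theorem carry_eq_sum {t : ℕ} (ht : 2 ≤ t) (e : ℕ → ℤ) (R : ℕ) :
    (carry t e R : ℝ) =
      -((t : ℝ) ^ R * ∑ n ∈ Finset.range (R + 1), (e n : ℝ) * (t : ℝ)⁻¹ ^ n) := by
  have ht0 : (t : ℝ) ≠ 0 := by positivity
  induction R with
  | zero => simp [carry]
  | succ R ih =>
    rw [Finset.sum_range_succ, carry]
    push_cast
    rw [ih, mul_add, mul_left_comm ((t : ℝ) ^ (R + 1)), ← mul_pow, mul_inv_cancel₀ ht0,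
      one_pow, pow_succ]
    ring

theorem exists_abs_carry_le {t : ℕ} (ht : 2 ≤ t) (M Q : ℕ) :
    ∃ C : ℕ, ∀ e : ℕ → ℤ, (∀ n, |(e n : ℝ)| ≤ M * (n + 1 : ℝ) ^ Q) →
      HasSum (fun n => (e n : ℝ) * (t : ℝ)⁻¹ ^ n) 0 → ∀ R,
        |(carry t e R : ℝ)| ≤ C * (R + 2 : ℝ) ^ Q := by
  obtain ⟨C, hC⟩ := exists_tail_bound ht M Q
  refine ⟨C, fun e he hsum R => ?_⟩
  have ht0 : (0 : ℝ) < t := by positivity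
  have h1 := hC (fun n => (e n : ℝ)) he (R + 1)
  have h2 := ((hasSum_nat_add_iff' (R + 1)).2 hsum).tsum_eq
  rw [h2, zero_sub, abs_neg] at h1
  rw [carry_eq_sum ht, abs_neg, abs_mul, abs_of_pos (by positivity : (0 : ℝ) < (t : ℝ) ^ R)]
  calc _ ≤ (t : ℝ) ^ R * _ := mul_le_mul_of_nonneg_left h1 (by positivity)
    _ = C * (R + 2 : ℝ) ^ Q * (t : ℝ)⁻¹ := by
      push_cast; rw [pow_succ, inv_pow]; field_simp; ring
    _ ≤ C * (R + 2 : ℝ) ^ Q * 1 := by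
      gcongr
      exact inv_le_one_of_one_le₀ (by exact_mod_cast (by omega : 1 ≤ t))
    _ = _ := mul_one _

theorem carry_add_le_neg_pow {t : ℕ} {e : ℕ → ℤ} {R K : ℕ}
    (he : ∀ n, R < n → n ≤ R + K → 0 ≤ e n) (hneg : carry t e R < 0) :
    carry t e (R + K) ≤ -(t : ℤ) ^ K := by
  induction K with
  | zero => simp only [add_zero, pow_zero]; omega
  | succ K ih =>
    have h1 := ih fun n hn hn' => he n hn (by omega)
    have h2 := he (R + K + 1) (by omega) (by omega)
    rw [← add_assoc, carry, pow_succ]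
    have h3 : (t : ℤ) * carry t e (R + K) ≤ t * (-(t : ℤ) ^ K) :=
      mul_le_mul_of_nonneg_left h1 (by positivity)
    linarith

theorem exists_mul_pow_lt_two_pow (C Q : ℕ) :
    ∃ E : ℕ, 1 ≤ E ∧ C * (2 * (E + 3)) ^ Q < 2 ^ E := by
  have h := (tendsto_pow_const_div_const_pow_of_one_lt Q (one_lt_two (α := ℝ))).comp
    (tendsto_add_atTop_nat 3)
  have h2 := h.const_mul (8 * C * 2 ^ Q : ℝ)
  rw [mul_zero] at h2
  obtain ⟨E, hE, hE1⟩ := ((h2.eventually (gt_mem_nhds one_pos)).and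
    (eventually_ge_atTop 1)).exists
  refine ⟨E, hE1, ?_⟩
  simp only [Function.comp_apply] at hE
  rw [← mul_div_assoc, div_lt_one (by positivity), pow_add] at hE
  have : (C * (2 * (E + 3)) ^ Q : ℝ) < 2 ^ E := by
    rw [mul_pow]
    push_cast at hE
    linarith
  exact_mod_cast this

theorem exists_carry_nonneg {t : ℕ} (ht : 2 ≤ t) (M Q : ℕ) :
    ∃ E : ℕ, 1 ≤ E ∧ ∀ e : ℕ → ℤ, (∀ n, |(e n : ℝ)| ≤ M * (n + 1 : ℝ) ^ Q) →
      HasSum (fun n => (e n : ℝ) * (t : ℝ)⁻¹ ^ n) 0 → ∀ N R, R ≤ N →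
        (∀ n, R < n → n ≤ R + E * (Nat.log 2 N + 1) → 0 ≤ e n) → 0 ≤ carry t e R := by
  obtain ⟨C, hC⟩ := exists_abs_carry_le ht M Q
  obtain ⟨E, hE1, hE⟩ := exists_mul_pow_lt_two_pow (C + 1) Q
  refine ⟨E, hE1, fun e he hsum N R hRN hwin => ?_⟩
  by_contra! hneg
  set g := Nat.log 2 N + 1 with hg
  have h1 := carry_add_le_neg_pow hwin hneg
  have h2 := (neg_abs_le _).trans' (neg_le_neg (hC e he hsum (R + E * g)))
  have h3 : (2 : ℝ) ^ (E * g) ≤ C * ((R + E * g : ℕ) + 2 : ℝ) ^ Q := by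
    have h1' : (carry t e (R + E * g) : ℝ) ≤ -(t : ℝ) ^ (E * g) := by exact_mod_cast h1
    have : (2 : ℝ) ^ (E * g) ≤ (t : ℝ) ^ (E * g) := by
      gcongr
      exact_mod_cast ht
    linarith
  have h4 : 2 ^ (E * g) ≤ C * (R + E * g + 2) ^ Q := by exact_mod_cast h3
  have hNg : N < 2 ^ g := Nat.lt_pow_succ_log_self one_lt_two N
  have hg2 : g < 2 ^ g := Nat.lt_two_pow_self
  have h5 : R + E * g + 2 ≤ 2 ^ g * (E + 3) := by
    have := Nat.mul_le_mul_left E hg2.le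
    nlinarith
  have h6 : C * (R + E * g + 2) ^ Q ≤ ((C + 1) * (2 * (E + 3)) ^ Q) ^ g := by
    calc C * (R + E * g + 2) ^ Q ≤ (C + 1) ^ g * (2 ^ g * (E + 3) ^ g) ^ Q := by
          gcongr
          · exact (Nat.le_succ C).trans (Nat.le_self_pow (by omega) _)
          · refine h5.trans ?_
            gcongr
            exact Nat.le_self_pow (by omega) _
      _ = _ := by
        rw [← mul_pow 2 (E + 3) g, mul_pow (C + 1), ← pow_mul, ← pow_mul, mul_comm g Q]
  have h7 : ((C + 1) * (2 * (E + 3)) ^ Q) ^ g < (2 ^ E) ^ g :=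
    Nat.pow_lt_pow_left hE (by omega)
  rw [← pow_mul] at h7
  omega

theorem coeff_mk_pow_add_ne_zero {b : ℕ → ℕ} {j n y : ℕ}
    (hn : PowerSeries.coeff n (PowerSeries.mk b ^ j) ≠ 0) (hy : b y ≠ 0) :
    PowerSeries.coeff (n + y) (PowerSeries.mk b ^ (j + 1)) ≠ 0 := by
  rw [pow_succ, PowerSeries.coeff_mul]
  refine (Finset.sum_pos' (fun _ _ => Nat.zero_le _)
    ⟨(n, y), by simp, ?_⟩).ne'
  rw [PowerSeries.coeff_mk]
  exact Nat.mul_pos (Nat.pos_of_ne_zero hn) (Nat.pos_of_ne_zero hy)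

theorem coeff_mk_pow_ne_zero_mono {b : ℕ → ℕ} (h0 : b 0 ≠ 0) {j j' n : ℕ} (hj : j ≤ j')
    (hn : PowerSeries.coeff n (PowerSeries.mk b ^ j) ≠ 0) :
    PowerSeries.coeff n (PowerSeries.mk b ^ j') ≠ 0 := by
  induction j', hj using Nat.le_induction with
  | base => exact hn
  | succ j' _ ih => simpa using coeff_mk_pow_add_ne_zero ih h0

theorem card_coeff_mk_pow_ne_zero_le (b : ℕ → ℕ) (N j : ℕ) :
    ((Finset.range N).filter fun n => PowerSeries.coeff n (PowerSeries.mk b ^ j) ≠ 0).card ≤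
      ((Finset.range N).filter fun n => b n ≠ 0).card ^ j := by
  classical
  induction j with
  | zero =>
    rw [pow_zero, pow_zero, Finset.card_le_one]
    intro u hu v hv
    rw [Finset.mem_filter, PowerSeries.coeff_one, ite_ne_right_iff] at hu hv
    rw [hu.2.1, hv.2.1]
  | succ j ih =>
    rw [pow_succ ((Finset.range N).filter fun n => b n ≠ 0).card]
    refine le_trans (Finset.card_le_card ?_)
      ((Finset.card_add_le (s := (Finset.range N).filter fun n =>
        PowerSeries.coeff n (PowerSeries.mk b ^ j) ≠ 0)
        (t := (Finset.range N).filter fun n => b n ≠ 0)).trans (Nat.mul_le_mul_right _ ih))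
    intro n hn
    rw [Finset.mem_filter, Finset.mem_range, pow_succ, PowerSeries.coeff_mul] at hn
    obtain ⟨⟨u, v⟩, huv, hne⟩ := Finset.exists_ne_zero_of_sum_ne_zero hn.2
    rw [Finset.HasAntidiagonal.mem_antidiagonal] at huv
    rw [PowerSeries.coeff_mk] at hne
    rw [Finset.mem_add]
    refine ⟨u, ?_, v, ?_, huv⟩
    · rw [Finset.mem_filter, Finset.mem_range]
      exact ⟨by omega, left_ne_zero_of_mul hne⟩
    · rw [Finset.mem_filter, Finset.mem_range]
      exact ⟨by omega, right_ne_zero_of_mul hne⟩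

theorem coeff_mk_pow_le {b : ℕ → ℕ} {M Q : ℕ} (hb : ∀ n, b n ≤ M * (n + 1) ^ Q) (j n : ℕ) :
    PowerSeries.coeff n (PowerSeries.mk b ^ j) ≤ M ^ j * (n + 1) ^ ((Q + 1) * j) := by
  induction j generalizing n with
  | zero =>
    rw [pow_zero, PowerSeries.coeff_one]
    split_ifs <;> simp
  | succ j ih =>
    rw [pow_succ, PowerSeries.coeff_mul]
    calc _ ≤ ∑ _p ∈ Finset.HasAntidiagonal.antidiagonal n,
          M ^ j * (n + 1) ^ ((Q + 1) * j) * (M * (n + 1) ^ Q) := by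
          refine Finset.sum_le_sum fun p hp => ?_
          rw [Finset.HasAntidiagonal.mem_antidiagonal] at hp
          rw [PowerSeries.coeff_mk]
          refine Nat.mul_le_mul ((ih _).trans ?_) ((hb _).trans ?_)
          · gcongr; omega
          · gcongr; omega
      _ = _ := by
          rw [Finset.sum_const, Finset.Nat.card_antidiagonal, smul_eq_mul]
          ring

theorem hasSum_coeff_mk_pow {b : ℕ → ℕ} {x β : ℝ}
    (hb : HasSum (fun n => (b n : ℝ) * x ^ n) β) (j : ℕ) :
    HasSum (fun n => ((PowerSeries.coeff n (PowerSeries.mk b ^ j) : ℕ) : ℝ) * x ^ n) (β ^ j) := by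
  induction j with
  | zero =>
    simp only [pow_zero]
    convert hasSum_ite_eq (0 : ℕ) (1 : ℝ) using 2 with n
    rw [PowerSeries.coeff_one]
    split_ifs with h <;> simp [h]
  | succ j ih =>
    have h1 := ih.summable.norm
    have h2 := hb.summable.norm
    have h3 := tsum_mul_tsum_eq_tsum_sum_antidiagonal_of_summable_norm h1 h2
    have h4 := (summable_norm_sum_mul_antidiagonal_of_summable_norm h1 h2).of_norm.hasSum
    rw [← h3, ih.tsum_eq, hb.tsum_eq, ← pow_succ] at h4
    refine Eq.mpr (congrArg (fun g => HasSum g (β ^ (j + 1))) (funext fun n => ?_)) h4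
    rw [pow_succ (PowerSeries.mk b), PowerSeries.coeff_mul]
    push_cast
    rw [Finset.sum_mul]
    refine Finset.sum_congr rfl fun p hp => ?_
    rw [Finset.HasAntidiagonal.mem_antidiagonal] at hp
    rw [PowerSeries.coeff_mk, ← hp, pow_add]
    ring

/-- Liouville's inequality for real algebraic numbers, rational ones included. -/
theorem exists_liouville_bound {α : ℝ} {f : ℤ[X]} (hf : f ≠ 0)
    (hα : aeval α f = 0) : ∃ (A : ℝ) (d : ℕ), 0 < A ∧ ∀ (a : ℤ) (q : ℕ), 1 ≤ q →
      α ≠ a / q → 1 ≤ (q : ℝ) ^ d * (|α - a / q| * A) := by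
  by_cases hirr : Irrational α
  · obtain ⟨A, hA, h⟩ := Liouville.exists_pos_real_of_irrational_root hirr hf
      (by rwa [eval_map_algebraMap])
    refine ⟨A, f.natDegree, hA, fun a q hq _ => ?_⟩
    obtain ⟨b, rfl⟩ : ∃ b, q = b + 1 := ⟨q - 1, by omega⟩
    simpa using h a b
  · rw [Irrational, not_not] at hirr
    obtain ⟨r, rfl⟩ := hirr
    refine ⟨r.den, 1, by exact_mod_cast r.pos, fun a q hq hne => ?_⟩
    have hq0 : (0 : ℝ) < q := by exact_mod_cast hq
    have hd0 : (0 : ℝ) < r.den := by exact_mod_cast r.pos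
    have hr : (r : ℝ) = r.num / r.den := by exact_mod_cast (Rat.num_div_den r).symm
    have hz : r.num * q - a * r.den ≠ 0 := by
      intro h0
      apply hne
      rw [hr, div_eq_div_iff hd0.ne' hq0.ne']
      exact_mod_cast sub_eq_zero.1 h0
    have h1 : (1 : ℝ) ≤ |(r.num * q - a * r.den : ℝ)| := by
      exact_mod_cast Int.one_le_abs hz
    have h2 : (r.num * q - a * r.den : ℝ) = q * ((r - a / q) * r.den) := by
      rw [hr]; field_simp
    rw [h2, abs_mul, abs_mul, abs_of_pos hq0, abs_of_pos hd0] at h1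
    simpa using h1

theorem exists_add_one_pow_le (Q : ℕ) : ∃ C : ℝ, 0 ≤ C ∧ ∀ s : ℕ,
    (s + 1 : ℝ) ^ Q ≤ C * (3 / 2 : ℝ) ^ s := by
  have h := (tendsto_pow_const_div_const_pow_of_one_lt Q
    (by norm_num : (1 : ℝ) < 3 / 2)).bddAbove_range
  obtain ⟨C, hC⟩ := h
  refine ⟨|C| * (3 / 2), by positivity, fun s => ?_⟩
  have h1 : ((s + 1 : ℕ) : ℝ) ^ Q / (3 / 2 : ℝ) ^ (s + 1) ≤ C := hC ⟨s + 1, rfl⟩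
  rw [div_le_iff₀ (by positivity), pow_succ] at h1
  push_cast at h1
  calc _ ≤ _ := h1
    _ ≤ |C| * ((3 / 2) ^ s * (3 / 2)) := by gcongr; exact le_abs_self C
    _ = _ := by ring

/-- If the base-`t` sum with digits `b` is algebraic, then the support of `b` has no large
multiplicative gaps. -/
theorem exists_support_growth {t : ℕ} (ht : 2 ≤ t) {b : ℕ → ℕ} {M Q : ℕ}
    (hb : ∀ n, b n ≤ M * (n + 1) ^ Q) (hinf : ∀ x, ∃ s, x < s ∧ b s ≠ 0) {β : ℝ}
    (hβ : HasSum (fun n => (b n : ℝ) * (t : ℝ)⁻¹ ^ n) β) {f : ℤ[X]} (hf : f ≠ 0)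
    (hroot : aeval β f = 0) :
    ∃ E : ℕ, ∀ x, ∃ s, b s ≠ 0 ∧ x < s ∧ s ≤ E * (x + 1) := by
  obtain ⟨C, hC⟩ := exists_tail_bound ht M Q
  obtain ⟨A, d, hA, hL⟩ := exists_liouville_bound hf hroot
  obtain ⟨C', hC'0, hC'⟩ := exists_add_one_pow_le Q
  obtain ⟨E₁, hE₁⟩ := pow_unbounded_of_one_lt (A * C * C') (by norm_num : (1 : ℝ) < 4 / 3)
  obtain ⟨E₂, hE₂⟩ := pow_unbounded_of_one_lt ((t : ℝ) ^ d) (by norm_num : (1 : ℝ) < 4 / 3)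
  have ht0 : (0 : ℝ) < t := by positivity
  have ht2 : (2 : ℝ) ≤ t := by exact_mod_cast ht
  refine ⟨E₁ + E₂, fun x => ?_⟩
  classical
  obtain ⟨hxs, hbs⟩ := Nat.find_spec (hinf x)
  have hmin : ∀ n, x < n → n < Nat.find (hinf x) → b n = 0 := fun n hn hns => by
    by_contra hne
    exact Nat.find_min (hinf x) hns ⟨hn, hne⟩
  set s := Nat.find (hinf x)
  refine ⟨s, hbs, hxs, ?_⟩
  have htail := (hasSum_nat_add_iff' s).2 hβ
  have hP : ∑ n ∈ Finset.range s, (b n : ℝ) * (t : ℝ)⁻¹ ^ n =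
      ((∑ n ∈ Finset.range (x + 1), (b n : ℤ) * (t : ℤ) ^ (x - n) : ℤ) : ℝ) /
        ((t ^ x : ℕ) : ℝ) := by
    rw [← Finset.sum_subset (Finset.range_mono hxs : Finset.range (x + 1) ⊆ Finset.range s)]
    · push_cast
      rw [Finset.sum_div]
      refine Finset.sum_congr rfl fun n hn => ?_
      have hnx : n ≤ x := Nat.lt_succ_iff.1 (Finset.mem_range.1 hn)
      rw [pow_sub₀ _ ht0.ne' hnx, inv_pow]
      field_simp
    · intro n hn hn'
      rw [Finset.mem_range] at hn hn'
      rw [hmin n (by omega) hn]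
      simp
  rw [hP] at htail
  have hpos : 0 < β - ((∑ n ∈ Finset.range (x + 1), (b n : ℤ) * (t : ℤ) ^ (x - n) : ℤ) : ℝ) /
        ((t ^ x : ℕ) : ℝ) := by
    refine lt_of_lt_of_le ?_ (le_hasSum htail 0 fun m _ => by positivity)
    rw [zero_add]
    have : (0 : ℝ) < b s := by exact_mod_cast Nat.pos_of_ne_zero hbs
    positivity
  have h1 := hL _ (t ^ x) (Nat.one_le_pow _ _ (by omega)) (sub_pos.1 hpos).ne'
  have h2 := hC (fun n => (b n : ℝ)) (fun n => by
    rw [Nat.abs_cast]; exact_mod_cast hb n) s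
  rw [htail.tsum_eq] at h2
  have h3 : 1 ≤ ((t : ℝ) ^ x) ^ d * ((C * (C' * (3 / 2 : ℝ) ^ s) * (t : ℝ)⁻¹ ^ s) * A) := by
    refine h1.trans ?_
    push_cast at h2 ⊢
    gcongr
    refine h2.trans ?_
    gcongr
    exact hC' s
  have h4 : (t : ℝ) ^ s ≤ ((t : ℝ) ^ d) ^ x * (A * C * C') * (3 / 2 : ℝ) ^ s := by
    calc (t : ℝ) ^ s = (t : ℝ) ^ s * 1 := (mul_one _).symm
      _ ≤ (t : ℝ) ^ s * _ := mul_le_mul_of_nonneg_left h3 (by positivity)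
      _ = _ := by rw [inv_pow, ← pow_mul, ← pow_mul, mul_comm x d]; field_simp
  have h5 : (4 / 3 : ℝ) ^ s * (3 / 2 : ℝ) ^ s ≤ (t : ℝ) ^ s := by
    rw [← mul_pow]
    gcongr
    linarith
  have h6 : (4 / 3 : ℝ) ^ s ≤ ((t : ℝ) ^ d) ^ x * (A * C * C') :=
    le_of_mul_le_mul_right (h5.trans h4) (by positivity)
  have h7 : (4 / 3 : ℝ) ^ s ≤ (4 / 3 : ℝ) ^ (E₂ * x + E₁) := by
    rw [pow_add, pow_mul]
    exact h6.trans (by gcongr)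
  have h8 := (pow_le_pow_iff_right₀ (by norm_num : (1 : ℝ) < 4 / 3)).1 h7
  nlinarith [Nat.zero_le (E₁ * x)]

theorem exists_le_log_mul_card_of_leadingCoeff_pos {t : ℕ} (ht : 2 ≤ t) {b : ℕ → ℕ} {M Q : ℕ}
    (h0 : b 0 ≠ 0) (hb : ∀ n, b n ≤ M * (n + 1) ^ Q) (hinf : ∀ x, ∃ s, x < s ∧ b s ≠ 0)
    {β : ℝ} (hβ : HasSum (fun n => (b n : ℝ) * (t : ℝ)⁻¹ ^ n) β) {f : ℤ[X]}
    (hlead : 0 < f.leadingCoeff) (hroot : aeval β f = 0) :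
    ∃ C : ℕ, ∀ N, N ≤ C * (Nat.log 2 N + 1) *
      ((Finset.range N).filter fun n => b n ≠ 0).card ^ f.natDegree := by
  have hf : f ≠ 0 := by
    rintro rfl
    simp at hlead
  obtain ⟨d, hd⟩ : ∃ d, f.natDegree = d + 1 := by
    refine Nat.exists_eq_succ_of_ne_zero fun hdeg => hf ?_
    rw [natDegree_eq_zero] at hdeg
    obtain ⟨c, rfl⟩ := hdeg
    have hc : (c : ℝ) = 0 := by simpa using hroot
    rw [Int.cast_eq_zero.1 hc, C_0]
  set r : ℕ → ℕ → ℕ := fun j n => PowerSeries.coeff n (PowerSeries.mk b ^ j)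
  set e : ℕ → ℤ := fun n => ∑ j ∈ Finset.range (f.natDegree + 1), f.coeff j * (r j n : ℤ)
    with he
  have hesum : HasSum (fun n => (e n : ℝ) * (t : ℝ)⁻¹ ^ n) 0 := by
    rw [← hroot, aeval_eq_sum_range]
    simp only [zsmul_eq_mul]
    have hs := hasSum_sum (s := Finset.range (f.natDegree + 1)) fun j _ =>
      (hasSum_coeff_mk_pow hβ j).mul_left (f.coeff j : ℝ)
    refine Eq.mpr (congrArg (fun g => HasSum g _) (funext fun n => ?_)) hs
    simp only [he]
    push_cast
    rw [Finset.sum_mul]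
    exact Finset.sum_congr rfl fun j _ => mul_assoc _ _ _
  have hebd : ∀ n, |(e n : ℝ)| ≤ ((∑ j ∈ Finset.range (f.natDegree + 1),
      (f.coeff j).natAbs * M ^ j : ℕ) : ℝ) * (n + 1 : ℝ) ^ ((Q + 1) * f.natDegree) := by
    intro n
    simp only [he]
    push_cast
    rw [Finset.sum_mul]
    refine (Finset.abs_sum_le_sum_abs _ _).trans (Finset.sum_le_sum fun j hj => ?_)
    rw [abs_mul, Nat.abs_cast, mul_assoc, Nat.cast_natAbs, Int.cast_abs]
    refine mul_le_mul_of_nonneg_left ?_ (abs_nonneg _)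
    have h1 : (r j n : ℝ) ≤ M ^ j * (n + 1 : ℝ) ^ ((Q + 1) * j) := by
      exact_mod_cast coeff_mk_pow_le hb j n
    refine h1.trans ?_
    gcongr
    · linarith [(Nat.cast_nonneg n : (0 : ℝ) ≤ n)]
    · exact Nat.lt_succ_iff.1 (Finset.mem_range.1 hj)
  have hmono : ∀ j n, j ≤ d → r d n = 0 → r j n = 0 := by
    intro j n hj hn
    by_contra hne
    exact coeff_mk_pow_ne_zero_mono h0 hj hne hn
  have he_top : ∀ n, r d n = 0 → e n = f.leadingCoeff * (r (d + 1) n : ℤ) := by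
    intro n hn
    simp only [he]
    rw [Finset.sum_range_succ, Finset.sum_eq_zero, zero_add, hd, leadingCoeff, hd]
    intro j hj
    rw [hd, Finset.mem_range] at hj
    rw [hmono j n (by omega) hn, Nat.cast_zero, mul_zero]
  have he_nonneg : ∀ n, r d n = 0 → 0 ≤ e n := fun n hn => by
    rw [he_top n hn]
    positivity
  have hsub : ∀ n, r d n ≠ 0 → r (d + 1) n ≠ 0 := fun n hn =>
    coeff_mk_pow_ne_zero_mono h0 (Nat.le_succ d) hn
  have he_zero : ∀ n, r (d + 1) n = 0 → e n = 0 := fun n hn => by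
    rw [he_top n (not_not.1 fun h => hsub n h hn), hn, Nat.cast_zero, mul_zero]
  obtain ⟨E, hE1, hE⟩ := exists_carry_nonneg ht (∑ j ∈ Finset.range (f.natDegree + 1),
      (f.coeff j).natAbs * M ^ j) ((Q + 1) * f.natDegree)
  obtain ⟨G, hG⟩ := exists_support_growth ht hb hinf hβ hf hroot
  refine ⟨(2 * G + 1) * E, fun N => ?_⟩
  have ht0 : (0 : ℤ) < t := by positivity
  have hcount := le_mul_card_of_carries {n | r d n ≠ 0} {n | r (d + 1) n ≠ 0} {n | b n ≠ 0}
    (carry t e) (K := E * (Nat.log 2 N + 1)) (E := G) (N := N)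
    (Nat.mul_pos hE1 (Nat.succ_pos _))
    (coeff_mk_pow_ne_zero_mono h0 (Nat.zero_le d) (by simp))
    hsub (fun i hi s hs => coeff_mk_pow_add_ne_zero hi hs) hG
    (fun R hR hw => hE e hebd hesum N R hR fun n hn hn' =>
      he_nonneg n (not_not.1 (hw n hn hn')))
    (fun R hR hw => by
      have hz : ∀ n, R < n → n ≤ R + E * (Nat.log 2 N + 1) → e n = 0 := fun n hn hn' =>
        he_zero n (not_not.1 (hw n hn hn'))
      have h1 := hE e hebd hesum N R hR fun n hn hn' => (hz n hn hn').ge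
      have h2 := hE (-e) (fun n => by simpa using hebd n) (by simpa using hesum.neg) N R hR
        fun n hn hn' => by simp [hz n hn hn']
      rw [carry_neg] at h2
      omega)
    (fun R hRA hT => by
      have h1 := he_nonneg (R + 1) (not_not.1 hRA)
      rw [carry] at hT
      exact pos_of_mul_pos_right (by linarith : 0 < (t : ℤ) * carry t e R) ht0.le)
    (fun R hRA hRA' hT => by
      have h1 : 0 < e (R + 1) := by
        rw [he_top _ (not_not.1 hRA)]
        exact mul_pos hlead (by exact_mod_cast Nat.pos_of_ne_zero hRA')
      rw [carry] at hT
      exact pos_of_mul_pos_right (by linarith : 0 < (t : ℤ) * carry t e R) ht0.le)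
  refine hcount.trans ?_
  rw [hd, mul_assoc (2 * G + 1) E]
  exact Nat.mul_le_mul_left _ (card_coeff_mk_pow_ne_zero_le b N (d + 1))

/-- Digits of polynomial growth whose base-`t` sum is a root of `f` have at least
`(N / log N) ^ (1 / deg f)` nonzero terms among the first `N`, up to a constant factor. -/
theorem exists_le_log_mul_card {t : ℕ} (ht : 2 ≤ t) {b : ℕ → ℕ} {M Q : ℕ}
    (h0 : b 0 ≠ 0) (hb : ∀ n, b n ≤ M * (n + 1) ^ Q) (hinf : ∀ x, ∃ s, x < s ∧ b s ≠ 0)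
    {β : ℝ} (hβ : HasSum (fun n => (b n : ℝ) * (t : ℝ)⁻¹ ^ n) β) {f : ℤ[X]}
    (hf : f ≠ 0) (hroot : aeval β f = 0) :
    ∃ C : ℕ, ∀ N, N ≤ C * (Nat.log 2 N + 1) *
      ((Finset.range N).filter fun n => b n ≠ 0).card ^ f.natDegree := by
  rcases lt_or_gt_of_ne (leadingCoeff_ne_zero.2 hf) with h | h
  · rw [← natDegree_neg f]
    refine exists_le_log_mul_card_of_leadingCoeff_pos ht h0 hb hinf hβ ?_ (by simp [hroot])
    rw [leadingCoeff_neg]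
    omega
  · exact exists_le_log_mul_card_of_leadingCoeff_pos ht h0 hb hinf hβ h hroot

theorem exists_int_polynomial {p : ℚ[X]} (hp : p ≠ 0) {α : ℝ} (hα : aeval α p = 0) :
    ∃ f : ℤ[X], f ≠ 0 ∧ f.natDegree = p.natDegree ∧ aeval α f = 0 := by
  obtain ⟨c, hc, h⟩ := IsLocalization.integerNormalization_spec (nonZeroDivisors ℤ) p
  have hc0 : (c : ℚ) ≠ 0 := by exact_mod_cast nonZeroDivisors.ne_zero hc
  set f := IsLocalization.integerNormalization (nonZeroDivisors ℤ) p
  have h' : f.map (algebraMap ℤ ℚ) = (c : ℚ) • p := by rw [h, Int.cast_smul_eq_zsmul]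
  refine ⟨f, ?_, ?_, ?_⟩
  · intro hf
    rw [hf, Polynomial.map_zero] at h'
    exact smul_ne_zero hc0 hp h'.symm
  · rw [← natDegree_map_eq_of_injective (algebraMap ℤ ℚ).injective_int f, h',
      natDegree_smul _ hc0]
  · rw [← aeval_map_algebraMap ℚ, h', map_smul, hα, smul_zero]

theorem log_two_add_one_le {N : ℕ} (hN : 2 ≤ N) :
    ((Nat.log 2 N + 1 : ℕ) : ℝ) ≤ 2 / Real.log 2 * Real.log N := by
  have h2 : 0 < Real.log 2 := Real.log_pos one_lt_two
  have h1 : (Nat.log 2 N : ℝ) ≤ Real.logb 2 N := by exact_mod_cast Real.natLog_le_logb N 2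
  have h3 : Real.log 2 ≤ Real.log N := Real.log_le_log two_pos (by exact_mod_cast hN)
  have h4 : 1 ≤ Real.log N / Real.log 2 := (one_le_div h2).2 h3
  rw [Real.logb] at h1
  push_cast
  calc _ ≤ Real.log N / Real.log 2 + Real.log N / Real.log 2 := by linarith
    _ = _ := by ring

theorem exists_le_mul_add_one_pow {a nk : ℕ → ℕ}
    (hcover : ∀ n, 1 ≤ n → a n ≠ 0 → ∃ k, nk k = n)
    (hQ : (fun k : ℕ => Real.log ((max (nk k) ((Finset.range (nk k + 1)).sup a) : ℕ) : ℝ))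
      =O[atTop] (fun k : ℕ => Real.log (nk k))) :
    ∃ M Q : ℕ, 1 ≤ M ∧ ∀ n, 1 ≤ n → a n ≤ M * (n + 1) ^ Q := by
  obtain ⟨c, hc⟩ := hQ.bound
  obtain ⟨Q, hQc⟩ := exists_nat_ge c
  obtain ⟨k₀, hk₀⟩ := eventually_atTop.1 hc
  refine ⟨1 + ∑ k ∈ Finset.range k₀, a (nk k), Q, Nat.le_add_right _ _, fun n hn => ?_⟩
  rcases Nat.eq_zero_or_pos (a n) with h | h
  · omega
  obtain ⟨k, rfl⟩ := hcover n hn h.ne'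
  rcases lt_or_ge k k₀ with hk | hk
  · have h1 : a (nk k) ≤ ∑ k ∈ Finset.range k₀, a (nk k) :=
      Finset.single_le_sum (f := fun k => a (nk k)) (fun _ _ => Nat.zero_le _)
        (Finset.mem_range.2 hk)
    exact (h1.trans (Nat.le_add_left _ _)).trans (Nat.le_mul_of_pos_right _ (by positivity))
  · have h1 := hk₀ k hk
    have hn0 : (0 : ℝ) < nk k := by exact_mod_cast hn
    have hlog : 0 ≤ Real.log (nk k) := Real.log_natCast_nonneg _
    have hle : a (nk k) ≤ max (nk k) ((Finset.range (nk k + 1)).sup a) :=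
      le_max_of_le_right (Finset.le_sup (f := a) (Finset.mem_range.2 (Nat.lt_succ_self _)))
    rw [Real.norm_eq_abs, Real.norm_eq_abs, abs_of_nonneg hlog] at h1
    have h2 : Real.log (a (nk k)) ≤ Real.log ((nk k : ℝ) ^ Q) := by
      rw [Real.log_pow]
      calc _ ≤ Real.log ((max (nk k) ((Finset.range (nk k + 1)).sup a) : ℕ) : ℝ) :=
            Real.log_le_log (by exact_mod_cast h) (by exact_mod_cast hle)
        _ ≤ _ := le_abs_self _
        _ ≤ _ := h1
        _ ≤ _ := by gcongr
    have h3 := (Real.log_le_log_iff (by exact_mod_cast h) (by positivity)).1 h2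
    have h4 : a (nk k) ≤ nk k ^ Q := by exact_mod_cast h3
    calc a (nk k) ≤ 1 * (nk k + 1) ^ Q := by
          rw [one_mul]; exact h4.trans (Nat.pow_le_pow_left (Nat.le_succ _) _)
      _ ≤ _ := Nat.mul_le_mul_right _ (Nat.le_add_right _ _)

theorem card_support_lt_le {b nk : ℕ → ℕ} (hmono : StrictMono nk)
    (hcover : ∀ n, 1 ≤ n → b n ≠ 0 → ∃ k, nk k = n) (k : ℕ) :
    ((Finset.range (nk k)).filter fun n => b n ≠ 0).card ≤ k + 1 := by
  have hsub : ((Finset.range (nk k)).filter fun n => b n ≠ 0) ⊆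
      insert 0 ((Finset.range k).image nk) := by
    intro n hn
    rw [Finset.mem_filter, Finset.mem_range] at hn
    rw [Finset.mem_insert, Finset.mem_image]
    rcases Nat.eq_zero_or_pos n with h | h
    · exact Or.inl h
    · obtain ⟨i, rfl⟩ := hcover n h hn.2
      exact Or.inr ⟨i, Finset.mem_range.2 (hmono.lt_iff_lt.1 hn.1), rfl⟩
  refine (Finset.card_le_card hsub).trans ((Finset.card_insert_le _ _).trans ?_)
  have := Finset.card_image_le (s := Finset.range k) (f := nk)
  rw [Finset.card_range] at this
  omega

theorem stmt9 (t : ℕ) (ht : 2 ≤ t) (a : ℕ → ℕ)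
    (hinf : {n : ℕ | 1 ≤ n ∧ a n ≠ 0}.Infinite)
    (nk : ℕ → ℕ) (hmono : StrictMono nk) (hpos : ∀ k, 1 ≤ nk k)
    (hsupp : ∀ k, a (nk k) ≠ 0)
    (hcover : ∀ n, 1 ≤ n → a n ≠ 0 → ∃ k, nk k = n)
    (hQ : (fun k : ℕ => Real.log ((max (nk k) ((Finset.range (nk k + 1)).sup a) : ℕ) : ℝ))
      =O[atTop] (fun k : ℕ => Real.log (nk k)))
    (ℓ : ℕ) (hℓ : 1 ≤ ℓ)
    (hgap : ∀ C : ℝ, ∃ᶠ k : ℕ in atTop,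
      C * ((k : ℝ) ^ ℓ * Real.log (nk k)) < (nk k : ℝ)) :
    ∀ p : Polynomial ℚ, p ≠ 0 →
      Polynomial.aeval (∑' n : ℕ, (a (n + 1) : ℝ) / t ^ (n + 1)) p = 0 →
      ℓ + 1 ≤ p.natDegree := by
  intro p hp hroot
  by_contra! hdeg
  obtain ⟨M, Q, hM, haM⟩ := exists_le_mul_add_one_pow hcover hQ
  set b : ℕ → ℕ := fun n => if n = 0 then 1 else a n with hb_def
  have hba : ∀ n, 1 ≤ n → b n = a n := fun n hn => if_neg (by omega)
  have hb : ∀ n, b n ≤ M * (n + 1) ^ Q := by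
    intro n
    rcases Nat.eq_zero_or_pos n with rfl | h
    · simpa [hb_def] using hM
    · exact (hba n h).trans_le (haM n h)
  have hb0 : b 0 ≠ 0 := by simp [hb_def]
  have hbinf : ∀ x, ∃ s, x < s ∧ b s ≠ 0 := fun x => by
    obtain ⟨s, hs, hxs⟩ := hinf.exists_gt x
    exact ⟨s, hxs, (hba s hs.1).trans_ne hs.2⟩
  have hsum : Summable fun n => (b n : ℝ) * (t : ℝ)⁻¹ ^ n :=
    summable_mul_inv_pow (M := M) (Q := Q) ht fun n => by
      rw [Nat.abs_cast]; exact_mod_cast hb n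
  have hβ := hsum.tsum_eq_zero_add
  set α := ∑' n : ℕ, (a (n + 1) : ℝ) / t ^ (n + 1)
  have hα : ∑' n : ℕ, (b (n + 1) : ℝ) * (t : ℝ)⁻¹ ^ (n + 1) = α :=
    tsum_congr fun n => by rw [hba _ (Nat.succ_pos n), inv_pow, div_eq_mul_inv]
  rw [hα, show b 0 = 1 from if_pos rfl, pow_zero, mul_one, Nat.cast_one] at hβ
  have hsum' := hsum.hasSum
  rw [hβ] at hsum'
  obtain ⟨f, hf, hfdeg, hfroot⟩ := exists_int_polynomial (p := p.comp (X - C 1)) (α := 1 + α)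
    (fun h => hp (by
      have := congrArg (fun q => q.comp (X + C 1)) h
      simpa [comp_assoc] using this))
    (by rw [aeval_comp]; simpa using hroot)
  rw [natDegree_comp, natDegree_X_sub_C, mul_one] at hfdeg
  obtain ⟨C, hC⟩ := exists_le_log_mul_card ht hb0 hb hbinf hsum' hf hfroot
  obtain ⟨k, hk, hk1⟩ := ((hgap (C * (2 / Real.log 2) * 2 ^ ℓ)).and_eventually
    (eventually_ge_atTop 1)).exists
  have hk2 : 2 ≤ nk k := by
    have := hmono (show 0 < k by omega)
    have := hpos 0
    omega
  have hlog := log_two_add_one_le hk2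
  have hcard : ((Finset.range (nk k)).filter fun n => b n ≠ 0).card ^ f.natDegree ≤
      2 ^ ℓ * k ^ ℓ := by
    have h1 := card_support_lt_le (b := b) hmono
      (fun n hn hne => hcover n hn ((hba n hn) ▸ hne)) k
    calc _ ≤ (k + 1) ^ f.natDegree := Nat.pow_le_pow_left h1 _
      _ ≤ (k + 1) ^ ℓ := Nat.pow_le_pow_right (Nat.succ_pos k) (by omega)
      _ ≤ (2 * k) ^ ℓ := Nat.pow_le_pow_left (by omega) _
      _ = _ := mul_pow _ _ _
  have hmain : (nk k : ℝ) ≤ C * (2 / Real.log 2 * Real.log (nk k)) * (2 ^ ℓ * (k : ℝ) ^ ℓ) := by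
    calc (nk k : ℝ) ≤ C * ((Nat.log 2 (nk k) + 1 : ℕ) : ℝ) *
          (((Finset.range (nk k)).filter fun n => b n ≠ 0).card ^ f.natDegree : ℕ) := by
          exact_mod_cast hC (nk k)
      _ ≤ C * (2 / Real.log 2 * Real.log (nk k)) * ((2 ^ ℓ * k ^ ℓ : ℕ) : ℝ) := by
          have : 0 ≤ Real.log 2 := Real.log_nonneg one_le_two
          gcongr
      _ = _ := by push_cast; ring
  refine absurd hk (not_lt.2 (hmain.trans_eq ?_))
  ring
end

section
/- Let t ≥ 2 and ℓ ≥ 2 be integers and f a polynomial with integer coefficients and positive leading coefficient. Then ∑_{n≥1} f(n)/t^{n^{ℓ+1}} is either transcendental or algebraic of degree at least ℓ + 1 over ℚ. In particular, for ℓ ≥ 2 it is not rational and not quadratic irrational. -/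
open Polynomial

/-- An interval that is long compared with the number of points of `E` it contains has a long
subinterval free of `E`. -/
theorem exists_free_block (E : ℕ → Prop) [DecidablePred E] (a b N e : ℕ)
    (hcard : ((Finset.Ico a b).filter E).card ≤ e) (hab : a + N * (e + 1) ≤ b) :
    ∃ R, a ≤ R ∧ R + N ≤ b ∧ ∀ k, R ≤ k → k < R + N → ¬ E k := by
  by_contra! hcon
  have hblock : ∀ i ∈ Finset.range (e + 1), a + N * i + N ≤ b := by
    intro i hi
    have hi' : i + 1 ≤ e + 1 := by simpa using hi
    have := Nat.mul_le_mul_left N hi'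
    linarith
  have hex : ∀ i, ∃ k, i ∈ Finset.range (e + 1) →
      a + N * i ≤ k ∧ k < a + N * i + N ∧ E k := by
    intro i
    by_cases hi : i ∈ Finset.range (e + 1)
    · obtain ⟨k, h⟩ := hcon (a + N * i) (by omega) (hblock i hi)
      exact ⟨k, fun _ => h⟩
    · exact ⟨0, fun h => absurd h hi⟩
  choose φ hφ using hex
  have hle : (Finset.range (e + 1)).card ≤ ((Finset.Ico a b).filter E).card := by
    refine Finset.card_le_card_of_injOn φ ?_ ?_
    · intro i hi
      have h := hφ i hi
      have := hblock i hi
      simp only [Finset.coe_filter, Finset.mem_Ico, Set.mem_ofPred_eq]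
      exact ⟨⟨by linarith [Nat.zero_le (N * i)], by omega⟩, h.2.2⟩
    · intro i hi j hj hij
      have h1 := hφ i hi
      have h2 := hφ j hj
      rw [hij] at h1
      rcases lt_trichotomy i j with h | h | h
      · have := Nat.mul_le_mul_left N (Nat.succ_le_of_lt h)
        rw [Nat.mul_succ] at this
        omega
      · exact h
      · have := Nat.mul_le_mul_left N (Nat.succ_le_of_lt h)
        rw [Nat.mul_succ] at this
        omega
  simp at hle
  omega

/-- If the points of `E₂` obtained by adding large `d`-th powers to points of `E₁` are never
isolated from `E₁` by `E₂`-free blocks of length `N`, then `E₂` is dense. -/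
theorem le_mul_card_of_no_isolated (E₁ E₂ : ℕ → Prop) [DecidablePred E₁] [DecidablePred E₂]
    (d n₀ N X : ℕ) (hd : d ≠ 0) (hn₀ : 1 ≤ n₀) (hN : 1 ≤ N) (hzero : E₁ 0) (hsub : ∀ k, E₁ k → E₂ k)
    (hadd : ∀ u m, E₁ u → n₀ ≤ m → E₂ (u + m ^ d))
    (hiso : ∀ R₁ R₂ s, R₁ ≤ s → s < R₂ → R₂ ≤ X → E₂ s →
      (∀ k, R₁ ≤ k → k < R₁ + N → ¬ E₂ k) → (∀ k, R₂ ≤ k → k < R₂ + N → ¬ E₂ k) →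
      (∀ k, R₁ ≤ k → k < R₂ → ¬ E₁ k) → False) (v : ℕ) (hv : v ≤ X) :
    v ≤ 3 * 2 ^ (d + 1) * n₀ ^ d * N * ((Finset.range v).filter E₂).card := by
  induction v using Nat.strong_induction_on with
  | _ v ih =>
  rcases Nat.eq_zero_or_pos v with rfl | hvpos
  · simp
  set K := 3 * 2 ^ (d + 1) * n₀ ^ d * N with hK
  obtain ⟨u, huv, hu, hfree⟩ : ∃ u, u < v ∧ E₁ u ∧ ∀ k, u < k → k < v → ¬ E₁ k := by
    refine ⟨Nat.findGreatest E₁ (v - 1), ?_, ?_, ?_⟩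
    · have := Nat.findGreatest_le (P := E₁) (v - 1)
      omega
    · exact Nat.findGreatest_spec (Nat.zero_le _) hzero
    · intro k hk hkv
      exact Nat.findGreatest_is_greatest hk (by omega)
  have hIH := ih u huv (by omega)
  set e := ((Finset.Ico u v).filter E₂).card with he
  have hcard : ((Finset.range v).filter E₂).card = ((Finset.range u).filter E₂).card + e := by
    rw [he, Finset.range_eq_Ico, Finset.range_eq_Ico, ← Finset.card_union_of_disjoint,
      ← Finset.filter_union, Finset.Ico_union_Ico_eq_Ico (Nat.zero_le _) huv.le]
    exact Finset.disjoint_filter_filter (Finset.Ico_disjoint_Ico_consecutive 0 u v)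
  have he1 : 1 ≤ e := by
    refine Finset.card_pos.mpr ⟨u, ?_⟩
    simp [huv, hsub u hu]
  suffices hgap : v - u ≤ K * e by
    rw [hcard, mul_add]
    omega
  by_contra! hH
  have hn₀d : 1 ≤ n₀ ^ d := Nat.one_le_pow _ _ hn₀
  have hKe : 3 * 2 ^ (d + 1) * n₀ ^ d * N * e < v - u := hH
  have hNe : 1 ≤ N * e := Nat.mul_pos hN he1
  have hbig : 6 * 2 ^ d * n₀ ^ d * (N * e) < v - u := by
    calc _ = 3 * 2 ^ (d + 1) * n₀ ^ d * N * e := by ring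
      _ < _ := hKe
  have h2d : 1 ≤ 2 ^ d := Nat.one_le_two_pow
  have hlarge : 2 * n₀ ^ d ≤ v - u := by
    refine le_trans ?_ hbig.le
    calc 2 * n₀ ^ d = 2 * 1 * n₀ ^ d * 1 := by ring
      _ ≤ 6 * 2 ^ d * n₀ ^ d * (N * e) := by gcongr; norm_num
  obtain ⟨m, hm, hm1, hm2⟩ : ∃ m, n₀ ≤ m ∧ 2 * m ^ d ≤ v - u ∧ v - u < 2 * (m + 1) ^ d := by
    have hself : ∀ k : ℕ, k ≤ k ^ d := fun k => Nat.le_self_pow hd k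
    have hle : n₀ ≤ v - u := by have := hself n₀; omega
    refine ⟨Nat.findGreatest (fun m => 2 * m ^ d ≤ v - u) (v - u),
      Nat.le_findGreatest hle hlarge,
      Nat.findGreatest_spec (P := fun m => 2 * m ^ d ≤ v - u) hle hlarge, ?_⟩
    by_contra! hcon
    have h1 := hself (Nat.findGreatest (fun m => 2 * m ^ d ≤ v - u) (v - u) + 1)
    have h2 := Nat.le_findGreatest (P := fun m => 2 * m ^ d ≤ v - u) (n := v - u)
      (by omega) hcon
    omega
  have hm3 : 3 * (N * e) ≤ m ^ d := by
    have h1 : (m + 1) ^ d ≤ 2 ^ d * m ^ d := by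
      rw [← mul_pow]
      exact Nat.pow_le_pow_left (by omega) d
    have h2 : 2 * 2 ^ d * (3 * (N * e)) ≤ 2 * 2 ^ d * m ^ d := by
      calc 2 * 2 ^ d * (3 * (N * e)) = 6 * 2 ^ d * 1 * (N * e) := by ring
        _ ≤ 6 * 2 ^ d * n₀ ^ d * (N * e) := by gcongr
        _ ≤ 2 * (m + 1) ^ d := (hbig.trans hm2).le
        _ ≤ 2 * 2 ^ d * m ^ d := by rw [mul_assoc]; gcongr
    exact Nat.le_of_mul_le_mul_left h2 (by positivity)
  have hNN : N ≤ N * e := Nat.le_mul_of_pos_right N he1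
  have hcount : ∀ a b, u ≤ a → b ≤ v → ((Finset.Ico a b).filter E₂).card ≤ e := fun a b ha hb =>
    Finset.card_le_card (Finset.filter_subset_filter _ (Finset.Ico_subset_Ico ha hb))
  obtain ⟨R₁, hR₁, hR₁', hf₁⟩ := exists_free_block E₂ (u + 1) (u + m ^ d) N e
    (hcount _ _ (by omega) (by omega)) (by rw [mul_add]; omega)
  obtain ⟨R₂, hR₂, hR₂', hf₂⟩ := exists_free_block E₂ (u + m ^ d + 1) v N e
    (hcount _ _ (by omega) le_rfl) (by rw [mul_add]; omega)
  exact hiso R₁ R₂ (u + m ^ d) (by omega) (by omega) (by omega) (hadd u m hu hm) hf₁ hf₂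
    fun k h1 h2 => hfree k (by omega) (by omega)

/-- A sequence of natural numbers with at most polynomial growth. -/
def PolyGrowth (a : ℕ → ℕ) : Prop := ∃ A q : ℕ, ∀ k, a k ≤ A * (k + 1) ^ q

theorem polyGrowth_coeff_mul (F G : PowerSeries ℕ) (hF : PolyGrowth fun k => PowerSeries.coeff k F)
    (hG : PolyGrowth fun k => PowerSeries.coeff k G) :
    PolyGrowth fun k => PowerSeries.coeff k (F * G) := by
  obtain ⟨A, q, hA⟩ := hF
  obtain ⟨B, r, hB⟩ := hG
  refine ⟨A * B, q + r + 1, fun k => ?_⟩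
  simp only at hA hB ⊢
  rw [PowerSeries.coeff_mul]
  calc ∑ p ∈ Finset.HasAntidiagonal.antidiagonal k,
        PowerSeries.coeff p.1 F * PowerSeries.coeff p.2 G
      ≤ ∑ p ∈ Finset.HasAntidiagonal.antidiagonal k, A * (k + 1) ^ q * (B * (k + 1) ^ r) := by
        refine Finset.sum_le_sum fun p hp => ?_
        have := Finset.HasAntidiagonal.mem_antidiagonal.mp hp
        refine Nat.mul_le_mul ((hA p.1).trans ?_) ((hB p.2).trans ?_)
        all_goals gcongr; omega
    _ = A * B * (k + 1) ^ (q + r + 1) := by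
        rw [Finset.sum_const, Finset.Nat.card_antidiagonal, smul_eq_mul]
        ring

theorem polyGrowth_coeff_pow (G : PowerSeries ℕ) (hG : PolyGrowth fun k => PowerSeries.coeff k G)
    (j : ℕ) : PolyGrowth fun k => PowerSeries.coeff k (G ^ j) := by
  induction j with
  | zero =>
    refine ⟨1, 0, fun k => ?_⟩
    simp only [pow_zero, PowerSeries.coeff_one]
    split_ifs <;> simp
  | succ j ih =>
    simp only [pow_succ]
    exact polyGrowth_coeff_mul _ _ ih hG

theorem summable_add_one_pow_mul_pow (q : ℕ) {x : ℝ} (hx0 : 0 ≤ x) (hx1 : x < 1) :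
    Summable fun k : ℕ => ((k : ℝ) + 1) ^ q * x ^ k := by
  by_cases hx : x = 0
  · refine summable_of_ne_finset_zero (s := {0}) fun k hk => ?_
    have : k ≠ 0 := by simpa using hk
    simp [hx, this]
  · have h := (summable_nat_add_iff 1).mpr
      (summable_pow_mul_geometric_of_norm_lt_one q (r := x) (by rwa [Real.norm_of_nonneg hx0]))
    refine (h.mul_left x⁻¹).congr fun k => ?_
    push_cast
    field_simp
    ring

theorem PolyGrowth.summable {a : ℕ → ℕ} (ha : PolyGrowth a) {x : ℝ} (hx0 : 0 ≤ x) (hx1 : x < 1) :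
    Summable fun k => (a k : ℝ) * x ^ k := by
  obtain ⟨A, q, hA⟩ := ha
  have h1 := summable_add_one_pow_mul_pow q hx0 hx1
  refine Summable.of_nonneg_of_le (fun k => by positivity) (fun k => ?_) (h1.mul_left (A : ℝ))
  rw [← mul_assoc]
  refine mul_le_mul_of_nonneg_right ?_ (by positivity)
  exact_mod_cast hA k

theorem hasSum_coeff_pow (G : PowerSeries ℕ) (hG : PolyGrowth fun k => PowerSeries.coeff k G)
    {x : ℝ} (hx0 : 0 ≤ x) (hx1 : x < 1) (j : ℕ) :
    HasSum (fun k => ((PowerSeries.coeff k (G ^ j) : ℕ) : ℝ) * x ^ k)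
      ((∑' k, ((PowerSeries.coeff k G : ℕ) : ℝ) * x ^ k) ^ j) := by
  induction j with
  | zero =>
    convert hasSum_ite_eq 0 (1 : ℝ) using 2 with k
    · by_cases h : k = 0 <;> simp [PowerSeries.coeff_one, h]
    · simp
  | succ j ih =>
    have hn1 := ih.summable.norm
    have hn2 := (hG.summable hx0 hx1).norm
    have key := tsum_mul_tsum_eq_tsum_sum_antidiagonal_of_summable_norm hn1 hn2
    have hs := (summable_norm_sum_mul_antidiagonal_of_summable_norm hn1 hn2).of_norm
    rw [pow_succ (∑' k, _) j, ← ih.tsum_eq, key, pow_succ]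
    refine hs.hasSum.congr_fun fun k => ?_
    rw [PowerSeries.coeff_mul]
    push_cast
    rw [Finset.sum_mul]
    refine Finset.sum_congr rfl fun p hp => ?_
    rw [← Finset.HasAntidiagonal.mem_antidiagonal.mp hp, pow_add]
    ring


/-- Partial sums, at the beginning of a long block of zeros, of a vanishing series
`∑ a k / t ^ k` with integer coefficients of polynomial growth, vanish. -/
theorem sum_range_eq_zero_of_zero_block (t : ℕ) (ht : 2 ≤ t) (a : ℕ → ℤ) (A q : ℕ)
    (ha : ∀ k, |a k| ≤ A * (k + 1) ^ q) (hsum : HasSum (fun k => (a k : ℝ) * (1 / (t : ℝ)) ^ k) 0)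
    (r : ℕ) (hr : r ≠ 0) :
    ∀ᶠ N : ℕ in Filter.atTop, ∀ R ≤ N ^ r, (∀ k, R ≤ k → k < R + N → a k = 0) →
      ∑ k ∈ Finset.range R, (a k : ℝ) * (1 / (t : ℝ)) ^ k = 0 := by
  have ht0 : (0 : ℝ) < t := by positivity
  set x : ℝ := 1 / (t : ℝ) with hx
  have hx0 : 0 < x := by positivity
  have hx1 : x < 1 := by
    rw [hx, div_lt_one ht0]
    exact_mod_cast (by omega : 1 < t)
  have htx : (t : ℝ) * x = 1 := by rw [hx]; field_simp
  have hS := summable_add_one_pow_mul_pow q hx0.le hx1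
  set C : ℝ := ∑' i : ℕ, ((i : ℝ) + 1) ^ q * x ^ i with hC
  have hlim : Filter.Tendsto (fun N : ℕ => A * 3 ^ q * C * ((N : ℝ) ^ (r * q) * x ^ N))
      Filter.atTop (nhds 0) := by
    simpa using (tendsto_pow_const_mul_const_pow_of_abs_lt_one (r * q)
      (by rwa [abs_of_pos hx0])).const_mul (A * 3 ^ q * C)
  filter_upwards [hlim.eventually_lt_const one_pos, Filter.eventually_ge_atTop 1] with
    N hNlt hN1 R hR hblock
  have hNr : N ≤ N ^ r := Nat.le_self_pow hr N
  have hterm : ∀ i : ℕ, ‖(t : ℝ) ^ R * ((a (i + (R + N)) : ℝ) * x ^ (i + (R + N)))‖ ≤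
      A * 3 ^ q * (N : ℝ) ^ (r * q) * x ^ N * (((i : ℝ) + 1) ^ q * x ^ i) := by
    intro i
    have h1 : (t : ℝ) ^ R * ((a (i + (R + N)) : ℝ) * x ^ (i + (R + N))) =
        (a (i + (R + N)) : ℝ) * (x ^ N * x ^ i) := by
      have : (t : ℝ) ^ R * x ^ R = 1 := by rw [← mul_pow, htx, one_pow]
      calc _ = (t : ℝ) ^ R * x ^ R * ((a (i + (R + N)) : ℝ) * (x ^ N * x ^ i)) := by ring
        _ = _ := by rw [this, one_mul]
    have h2 : |(a (i + (R + N)) : ℝ)| ≤ A * ((i + (R + N) : ℕ) + 1) ^ q := by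
      exact_mod_cast ha (i + (R + N))
    have h3 : (i + (R + N)) + 1 ≤ 3 * N ^ r * (i + 1) := by nlinarith
    have h3' : (((i + (R + N) : ℕ) : ℝ) + 1) ≤ 3 * (N : ℝ) ^ r * (i + 1) := by exact_mod_cast h3
    rw [h1, norm_mul, Real.norm_eq_abs, Real.norm_of_nonneg (by positivity : 0 ≤ x ^ N * x ^ i)]
    calc _ ≤ A * (3 * (N : ℝ) ^ r * (i + 1)) ^ q * (x ^ N * x ^ i) := by
          refine mul_le_mul_of_nonneg_right (h2.trans ?_) (by positivity)
          gcongr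
      _ = _ := by rw [mul_pow, mul_pow, ← pow_mul]; ring
  have htail : ‖∑' i : ℕ, (t : ℝ) ^ R * ((a (i + (R + N)) : ℝ) * x ^ (i + (R + N)))‖ < 1 := by
    refine (tsum_of_norm_bounded (hS.hasSum.mul_left _) hterm).trans_lt ?_
    calc _ = A * 3 ^ q * C * ((N : ℝ) ^ (r * q) * x ^ N) := by rw [hC]; ring
      _ < 1 := hNlt
  have hsplit := hsum.summable.sum_add_tsum_nat_add (R + N)
  rw [hsum.tsum_eq, Finset.sum_range_add] at hsplit
  have hz : ∑ k ∈ Finset.range N, (a (R + k) : ℝ) * x ^ (R + k) = 0 := by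
    refine Finset.sum_eq_zero fun k hk => ?_
    rw [hblock (R + k) (by omega) (by have := Finset.mem_range.mp hk; omega)]
    simp
  rw [hz, add_zero] at hsplit
  have hint : (t : ℝ) ^ R * ∑ k ∈ Finset.range R, (a k : ℝ) * x ^ k =
      ((∑ k ∈ Finset.range R, a k * (t : ℤ) ^ (R - k) : ℤ) : ℝ) := by
    push_cast
    rw [Finset.mul_sum]
    refine Finset.sum_congr rfl fun k hk => ?_
    have hk' := Finset.mem_range.mp hk
    have : (t : ℝ) ^ R * x ^ k = (t : ℝ) ^ (R - k) := by
      calc (t : ℝ) ^ R * x ^ k = (t : ℝ) ^ (R - k + k) * x ^ k := by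
            rw [Nat.sub_add_cancel hk'.le]
        _ = (t : ℝ) ^ (R - k) * ((t : ℝ) * x) ^ k := by rw [pow_add, mul_pow]; ring
        _ = _ := by rw [htx]; simp
    rw [← this]
    ring
  rw [tsum_mul_left] at htail
  have heq : (t : ℝ) ^ R * ∑' i : ℕ, (a (i + (R + N)) : ℝ) * x ^ (i + (R + N)) =
      -((∑ k ∈ Finset.range R, a k * (t : ℤ) ^ (R - k) : ℤ) : ℝ) := by
    rw [← hint]
    linear_combination (t : ℝ) ^ R * hsplit
  rw [heq, norm_neg, Real.norm_eq_abs] at htail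
  have hzero : (∑ k ∈ Finset.range R, a k * (t : ℤ) ^ (R - k) : ℤ) = 0 :=
    Int.abs_lt_one_iff.mp (by exact_mod_cast htail)
  rw [hzero, Int.cast_zero] at hint
  exact (mul_eq_zero.mp hint).resolve_left (by positivity)

theorem coeff_pow_le_coeff_pow_succ (G : PowerSeries ℕ) (h0 : PowerSeries.coeff 0 G ≠ 0) (j k : ℕ) :
    PowerSeries.coeff k (G ^ j) ≤ PowerSeries.coeff k (G ^ (j + 1)) := by
  rw [pow_succ, PowerSeries.coeff_mul]
  calc PowerSeries.coeff k (G ^ j)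
      ≤ PowerSeries.coeff k (G ^ j) * PowerSeries.coeff 0 G :=
        Nat.le_mul_of_pos_right _ (Nat.pos_of_ne_zero h0)
    _ ≤ _ := Finset.single_le_sum
        (f := fun p : ℕ × ℕ => PowerSeries.coeff p.1 (G ^ j) * PowerSeries.coeff p.2 G)
        (fun _ _ => Nat.zero_le _)
        (Finset.HasAntidiagonal.mem_antidiagonal.mpr (add_zero k) :
          (k, 0) ∈ Finset.HasAntidiagonal.antidiagonal k)

theorem coeff_pow_mono (G : PowerSeries ℕ) (h0 : PowerSeries.coeff 0 G ≠ 0) (k : ℕ) :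
    Monotone fun j => PowerSeries.coeff k (G ^ j) :=
  monotone_nat_of_le_succ fun j => coeff_pow_le_coeff_pow_succ G h0 j k

theorem coeff_pow_succ_add_ne_zero (G : PowerSeries ℕ) (j u v : ℕ)
    (hu : PowerSeries.coeff u (G ^ j) ≠ 0) (hv : PowerSeries.coeff v G ≠ 0) :
    PowerSeries.coeff (u + v) (G ^ (j + 1)) ≠ 0 := by
  rw [pow_succ, PowerSeries.coeff_mul]
  intro hsum
  exact mul_ne_zero hu hv (Finset.sum_eq_zero_iff.mp hsum (u, v)
    (Finset.HasAntidiagonal.mem_antidiagonal.mpr rfl))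

/-- A power series supported on `d`-th powers has a `j`-th power with sparse support. -/
theorem card_support_coeff_pow_le (G : PowerSeries ℕ) (d : ℕ)
    (hsupp : ∀ k, PowerSeries.coeff k G ≠ 0 → ∃ n, n ^ d = k) (M j : ℕ) :
    ((Finset.range (M ^ d)).filter fun k => PowerSeries.coeff k (G ^ j) ≠ 0).card ≤ M ^ j := by
  induction j with
  | zero =>
    refine (Finset.card_le_card (t := {0}) fun k hk => ?_).trans (by simp)
    have := (Finset.mem_filter.mp hk).2
    rw [pow_zero, PowerSeries.coeff_one] at this
    simpa using this
  | succ j ih =>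
    refine (Finset.card_le_card (t := Finset.image₂ (fun a n => a + n ^ d)
      ((Finset.range (M ^ d)).filter fun k => PowerSeries.coeff k (G ^ j) ≠ 0)
      (Finset.range M)) fun k hk => ?_).trans ((Finset.card_image₂_le _ _ _).trans ?_)
    · obtain ⟨hkM, hk0⟩ := Finset.mem_filter.mp hk
      rw [pow_succ, PowerSeries.coeff_mul] at hk0
      obtain ⟨⟨a, b⟩, hab, hne⟩ := Finset.exists_ne_zero_of_sum_ne_zero hk0
      have hab' : a + b = k := Finset.HasAntidiagonal.mem_antidiagonal.mp hab
      obtain ⟨ha, hb⟩ := mul_ne_zero_iff.mp hne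
      obtain ⟨n, rfl⟩ := hsupp b hb
      have hkM' := Finset.mem_range.mp hkM
      refine Finset.mem_image₂.mpr ⟨a, ?_, n, ?_, hab'⟩
      · exact Finset.mem_filter.mpr ⟨Finset.mem_range.mpr (by omega), ha⟩
      · exact Finset.mem_range.mpr (lt_of_pow_lt_pow_left₀ d (Nat.zero_le _) (by omega))
    · rw [Finset.card_range, pow_succ]
      gcongr

/-- The value at `1 / t` of a power series with natural coefficients of polynomial growth, whose
support consists of `d`-th powers and contains `0` and all large `d`-th powers, is not a root of a
nonzero integer polynomial of degree less than `d`. -/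
theorem aeval_tsum_ne_zero (t : ℕ) (ht : 2 ≤ t) (d : ℕ) (G : PowerSeries ℕ)
    (h0 : PowerSeries.coeff 0 G ≠ 0) (hgrow : PolyGrowth fun k => PowerSeries.coeff k G)
    (hsupp : ∀ k, PowerSeries.coeff k G ≠ 0 → ∃ n, n ^ d = k)
    (n₀ : ℕ) (hn₀ : 1 ≤ n₀) (hlarge : ∀ n, n₀ ≤ n → PowerSeries.coeff (n ^ d) G ≠ 0)
    (P : ℤ[X]) (hP : P ≠ 0) (hdeg : P.natDegree < d) :
    aeval (∑' k, ((PowerSeries.coeff k G : ℕ) : ℝ) * (1 / (t : ℝ)) ^ k) P ≠ 0 := by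
  classical
  intro hroot
  have hd : d ≠ 0 := by omega
  set x : ℝ := 1 / (t : ℝ) with hx
  have ht0 : (0 : ℝ) < t := by positivity
  have hx0 : 0 < x := by positivity
  have hx1 : x < 1 := by
    rw [hx, div_lt_one ht0]
    exact_mod_cast (by omega : 1 < t)
  obtain ⟨D, hD⟩ : ∃ D, P.natDegree = D + 1 := by
    refine Nat.exists_eq_succ_of_ne_zero fun h => hP ?_
    rw [eq_C_of_natDegree_eq_zero h, aeval_C] at hroot
    rw [eq_C_of_natDegree_eq_zero h]
    have : P.coeff 0 = 0 := by simpa using hroot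
    rw [this, C_0]
  set a : ℕ → ℤ := fun k =>
    ∑ j ∈ Finset.range (D + 2), P.coeff j * (PowerSeries.coeff k (G ^ j) : ℕ) with ha
  have hasum : HasSum (fun k => (a k : ℝ) * x ^ k) 0 := by
    have h : HasSum (fun k => ∑ j ∈ Finset.range (D + 2),
        (P.coeff j : ℝ) * (((PowerSeries.coeff k (G ^ j) : ℕ) : ℝ) * x ^ k)) _ :=
      hasSum_sum fun j _ => (hasSum_coeff_pow G hgrow hx0.le hx1 j).mul_left (P.coeff j : ℝ)
    rw [aeval_eq_sum_range, hD] at hroot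
    simp only [zsmul_eq_mul] at hroot
    rw [hroot] at h
    refine h.congr_fun fun k => ?_
    simp only [ha]
    push_cast
    rw [Finset.sum_mul]
    exact Finset.sum_congr rfl fun j _ => by ring
  obtain ⟨A, q, hA⟩ := polyGrowth_coeff_pow G hgrow (D + 1)
  have habound : ∀ k, |a k| ≤
      ((∑ j ∈ Finset.range (D + 2), (P.coeff j).natAbs) * A : ℕ) * ((k : ℤ) + 1) ^ q := by
    intro k
    refine (Finset.abs_sum_le_sum_abs _ _).trans ?_
    push_cast
    rw [mul_assoc, Finset.sum_mul]
    refine Finset.sum_le_sum fun j hj => ?_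
    rw [abs_mul, Nat.abs_cast]
    refine mul_le_mul_of_nonneg_left ?_ (abs_nonneg _)
    have h1 := coeff_pow_mono G h0 k (Nat.lt_succ_iff.mp (Finset.mem_range.mp hj))
    exact_mod_cast h1.trans (hA k)
  set E₁ : ℕ → Prop := fun k => PowerSeries.coeff k (G ^ D) ≠ 0 with hE₁
  set E₂ : ℕ → Prop := fun k => PowerSeries.coeff k (G ^ (D + 1)) ≠ 0 with hE₂
  have ha₁ : ∀ k, ¬ E₁ k →
      a k = P.coeff (D + 1) * (PowerSeries.coeff k (G ^ (D + 1)) : ℕ) := by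
    intro k hk
    have hk' : PowerSeries.coeff k (G ^ D) = 0 := not_not.mp hk
    simp only [ha]
    rw [Finset.sum_range_succ, Finset.sum_eq_zero, zero_add]
    intro j hj
    have h1 := coeff_pow_mono G h0 k (Nat.lt_succ_iff.mp (Finset.mem_range.mp hj))
    simp only [hk', Nat.le_zero] at h1
    rw [h1]
    simp
  have hsub : ∀ k, E₁ k → E₂ k := fun k hk hk2 =>
    hk (Nat.le_zero.mp (hk2 ▸ coeff_pow_le_coeff_pow_succ G h0 D k))
  have ha₂ : ∀ k, ¬ E₂ k → a k = 0 := by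
    intro k hk
    rw [ha₁ k fun h => hk (hsub k h), not_not.mp hk]
    simp
  have hE₁0 : E₁ 0 := by
    simp only [hE₁, PowerSeries.coeff_zero_eq_constantCoeff, map_pow] at h0 ⊢
    exact pow_ne_zero _ h0
  have hlead : (P.coeff (D + 1) : ℝ) ≠ 0 := by
    rw [← hD]
    exact_mod_cast leadingCoeff_ne_zero.mpr hP
  have hvanish := sum_range_eq_zero_of_zero_block t ht a _ q habound hasum (2 * d) (by omega)
  obtain ⟨N, hN, hNK, hN1⟩ := (hvanish.and ((Filter.eventually_gt_atTop
    (3 * 2 ^ (d + 1) * n₀ ^ d)).and (Filter.eventually_ge_atTop 1))).exists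
  have hiso : ∀ R₁ R₂ s, R₁ ≤ s → s < R₂ → R₂ ≤ N ^ (2 * d) → E₂ s →
      (∀ k, R₁ ≤ k → k < R₁ + N → ¬ E₂ k) → (∀ k, R₂ ≤ k → k < R₂ + N → ¬ E₂ k) →
      (∀ k, R₁ ≤ k → k < R₂ → ¬ E₁ k) → False := by
    intro R₁ R₂ s h1 h2 h3 hs hf1 hf2 hf
    have hz1 := hN R₁ (by omega) fun k hk hk' => ha₂ k (hf1 k hk hk')
    have hz2 := hN R₂ h3 fun k hk hk' => ha₂ k (hf2 k hk hk')
    have hz : ∑ k ∈ Finset.Ico R₁ R₂, (a k : ℝ) * x ^ k = 0 := by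
      rw [Finset.sum_Ico_eq_sub _ (by omega), hz1, hz2, sub_zero]
    have hz' : (P.coeff (D + 1) : ℝ) * ∑ k ∈ Finset.Ico R₁ R₂,
        ((PowerSeries.coeff k (G ^ (D + 1)) : ℕ) : ℝ) * x ^ k = 0 := by
      rw [← hz, Finset.mul_sum]
      refine Finset.sum_congr rfl fun k hk => ?_
      obtain ⟨hk1, hk2⟩ := Finset.mem_Ico.mp hk
      rw [ha₁ k (hf k hk1 hk2)]
      push_cast
      ring
    have hpos : 0 < ∑ k ∈ Finset.Ico R₁ R₂,
        ((PowerSeries.coeff k (G ^ (D + 1)) : ℕ) : ℝ) * x ^ k := by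
      refine Finset.sum_pos' (fun k _ => by positivity) ⟨s, Finset.mem_Ico.mpr ⟨h1, h2⟩, ?_⟩
      have : (0 : ℝ) < (PowerSeries.coeff s (G ^ (D + 1)) : ℕ) :=
        Nat.cast_pos.mpr (Nat.pos_of_ne_zero hs)
      positivity
    exact (mul_ne_zero hlead hpos.ne') hz'
  have hdense := le_mul_card_of_no_isolated E₁ E₂ d n₀ N (N ^ (2 * d)) hd hn₀ hN1 hE₁0 hsub
    (fun u m hu hm => coeff_pow_succ_add_ne_zero G D u (m ^ d) hu (hlarge m hm)) hiso
    (N ^ (2 * d)) le_rfl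
  have hcard := card_support_coeff_pow_le G d hsupp (N ^ 2) (D + 1)
  rw [← pow_mul] at hcard
  obtain ⟨c, rfl⟩ : ∃ c, d = c + 1 := Nat.exists_eq_succ_of_ne_zero hd
  have hsparse : (N ^ 2) ^ (D + 1) ≤ N ^ (2 * c) := by
    rw [← pow_mul]
    exact Nat.pow_le_pow_right hN1 (by omega)
  have hfinal : N ^ (2 * c + 1) * N ≤ N ^ (2 * c + 1) * (3 * 2 ^ (c + 1 + 1) * n₀ ^ (c + 1)) := by
    calc N ^ (2 * c + 1) * N = N ^ (2 * (c + 1)) := by ring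
      _ ≤ _ := hdense
      _ ≤ 3 * 2 ^ (c + 1 + 1) * n₀ ^ (c + 1) * N * N ^ (2 * c) :=
        Nat.mul_le_mul_left _ (hcard.trans hsparse)
      _ = _ := by ring
  exact absurd (Nat.le_of_mul_le_mul_left hfinal (by positivity)) (by omega)

theorem exists_natAbs_eval_le (f : ℤ[X]) :
    ∃ A q : ℕ, ∀ n : ℕ, (f.eval (n : ℤ)).natAbs ≤ A * (n + 1) ^ q := by
  refine ⟨∑ i ∈ Finset.range (f.natDegree + 1), (f.coeff i).natAbs, f.natDegree, fun n => ?_⟩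
  rw [eval_eq_sum_range, Finset.sum_mul]
  refine (Int.natAbs_sum_le _ _).trans (Finset.sum_le_sum fun i hi => ?_)
  rw [Int.natAbs_mul, Int.natAbs_pow, Int.natAbs_natCast]
  refine Nat.mul_le_mul_left _ ?_
  calc n ^ i ≤ (n + 1) ^ i := Nat.pow_le_pow_left (by omega) i
    _ ≤ _ := Nat.pow_le_pow_right (by omega) (by have := Finset.mem_range.mp hi; omega)

theorem eventually_eval_natCast_pos (f : ℤ[X]) (hf : 0 < f.leadingCoeff) :
    ∀ᶠ n : ℕ in Filter.atTop, 0 < f.eval (n : ℤ) := by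
  rcases Nat.eq_zero_or_pos f.natDegree with h | h
  · refine Filter.Eventually.of_forall fun n => ?_
    rw [leadingCoeff, h] at hf
    rw [eq_C_of_natDegree_eq_zero h, eval_C]
    exact hf
  · set g : ℝ[X] := f.map (Int.castRingHom ℝ) with hg
    have hdeg : g.degree = f.degree :=
      degree_map_eq_of_injective (RingHom.injective_int _) f
    have hlead : g.leadingCoeff = f.leadingCoeff := by
      rw [hg, leadingCoeff_map_of_injective (RingHom.injective_int _)]
      simp
    have ht := (tendsto_atTop_of_leadingCoeff_nonneg g
      (by rw [hdeg]; exact natDegree_pos_iff_degree_pos.mp h)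
      (by rw [hlead]; exact_mod_cast hf.le)).comp (tendsto_natCast_atTop_atTop (R := ℝ))
    filter_upwards [ht.eventually_gt_atTop 0] with n hn
    simp only [Function.comp_apply, hg] at hn
    rw [← Int.cast_natCast n, ← eq_intCast (Int.castRingHom ℝ) (n : ℤ), eval_map_apply,
      eq_intCast] at hn
    exact_mod_cast hn

/-- Up to a rational summand, the series `∑ f (n + 1) / t ^ (n + 1) ^ d` is the value
at `1 / t` of a power series with natural coefficients. -/
theorem exists_powerSeries_tsum_eq (t : ℕ) (ht : 2 ≤ t) (d : ℕ) (hd : d ≠ 0)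
    (f : ℤ[X]) (hf : 0 < f.leadingCoeff) :
    ∃ (G : PowerSeries ℕ) (n₀ : ℕ) (r : ℚ), PowerSeries.coeff 0 G ≠ 0 ∧
      (PolyGrowth fun k => PowerSeries.coeff k G) ∧
      (∀ k, PowerSeries.coeff k G ≠ 0 → ∃ n, n ^ d = k) ∧ 1 ≤ n₀ ∧
      (∀ n, n₀ ≤ n → PowerSeries.coeff (n ^ d) G ≠ 0) ∧
      ∑' n : ℕ, ((f.eval ((n : ℤ) + 1) : ℤ) : ℝ) / t ^ ((n + 1) ^ d) =
        (∑' k, ((PowerSeries.coeff k G : ℕ) : ℝ) * (1 / (t : ℝ)) ^ k) + r := by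
  obtain ⟨m, hm⟩ := Filter.eventually_atTop.mp (eventually_eval_natCast_pos f hf)
  obtain ⟨A, q, hA⟩ := exists_natAbs_eval_le f
  have ht0 : (0 : ℝ) < t := by positivity
  set x : ℝ := 1 / (t : ℝ) with hx
  have hx0 : 0 < x := by positivity
  have hx1 : x < 1 := by
    rw [hx, div_lt_one ht0]
    exact_mod_cast (by omega : 1 < t)
  set φ : ℕ → ℕ := fun n => (n + (m + 1)) ^ d with hφ
  have hinj : Function.Injective φ := fun i j hij => by
    have := Nat.pow_left_injective hd hij
    omega
  set w : ℕ → ℕ := fun n => (f.eval ((n + (m + 1) : ℕ) : ℤ)).toNat with hw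
  set b : ℕ → ℕ := Function.extend φ w 0 with hb
  have hb0 : b 0 = 0 := by
    refine Function.extend_apply' _ _ _ ?_
    rintro ⟨n, hn⟩
    exact absurd hn (pow_ne_zero d (by omega))
  have hbgrow : ∀ k, b k ≤ A * (k + 1) ^ q := by
    intro k
    by_cases hk : ∃ n, φ n = k
    · obtain ⟨n, rfl⟩ := hk
      rw [hb, hinj.extend_apply]
      calc w n ≤ (f.eval ((n + (m + 1) : ℕ) : ℤ)).natAbs := by simp only [hw]; omega
        _ ≤ A * ((n + (m + 1)) + 1) ^ q := hA _
        _ ≤ A * (φ n + 1) ^ q := by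
          gcongr
          exact Nat.le_self_pow hd _
    · rw [hb, Function.extend_apply' _ _ _ hk]
      simp
  have hwcast : ∀ n, (w n : ℝ) = (f.eval ((n + (m + 1) : ℕ) : ℤ) : ℤ) := by
    intro n
    have : (w n : ℤ) = f.eval ((n + (m + 1) : ℕ) : ℤ) :=
      Int.toNat_of_nonneg (hm _ (by omega)).le
    exact_mod_cast this
  set G : PowerSeries ℕ := PowerSeries.mk fun k => if k = 0 then 1 else b k with hG
  have hGcoeff : ∀ k, PowerSeries.coeff k G = if k = 0 then 1 else b k := fun k => by
    rw [hG, PowerSeries.coeff_mk]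
  have hGne : ∀ k, k ≠ 0 → PowerSeries.coeff k G = b k := fun k hk => by rw [hGcoeff, if_neg hk]
  have hbsum : Summable fun k => (b k : ℝ) * x ^ k := PolyGrowth.summable ⟨A, q, hbgrow⟩ hx0.le hx1
  have hGsum : ∑' k, ((PowerSeries.coeff k G : ℕ) : ℝ) * x ^ k = 1 + ∑' k, (b k : ℝ) * x ^ k := by
    rw [← tsum_ite_eq (0 : ℕ) (fun _ => (1 : ℝ)),
      ← (hasSum_ite_eq 0 (1 : ℝ)).summable.tsum_add hbsum]
    refine tsum_congr fun k => ?_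
    rw [hGcoeff]
    by_cases hk : k = 0 <;> simp [hk, hb0]
  have hext : ∀ k, (b k : ℝ) * x ^ k = Function.extend φ (fun n => (w n : ℝ) * x ^ φ n) 0 k := by
    intro k
    by_cases hk : ∃ n, φ n = k
    · obtain ⟨n, rfl⟩ := hk
      rw [hb, hinj.extend_apply, hinj.extend_apply]
    · rw [hb, Function.extend_apply' _ _ _ hk, Function.extend_apply' _ _ _ hk]
      simp
  set u : ℕ → ℝ := fun n => ((f.eval ((n : ℤ) + 1) : ℤ) : ℝ) / t ^ ((n + 1) ^ d) with hu
  have hshift : ∀ n, u (n + m) = (b (φ n) : ℝ) * x ^ φ n := by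
    intro n
    rw [hb, hinj.extend_apply, hwcast, hx, one_div, inv_pow, ← div_eq_mul_inv]
    simp only [hu, hφ]
    push_cast
    rw [add_assoc, add_assoc]
  have husum : Summable u := by
    rw [← summable_nat_add_iff m]
    exact (hbsum.comp_injective hinj).congr fun n => (hshift n).symm
  refine ⟨G, m + 1,
    (∑ n ∈ Finset.range m, ((f.eval ((n : ℤ) + 1) : ℤ) : ℚ) / (t : ℚ) ^ ((n + 1) ^ d)) - 1,
    ?_, ?_, ?_, by omega, ?_, ?_⟩
  · rw [hGcoeff]
    simp
  · refine ⟨A + 1, q, fun k => ?_⟩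
    simp only [hGcoeff]
    have h1 : 1 ≤ (k + 1) ^ q := Nat.one_le_pow _ _ (by omega)
    have h2 := hbgrow k
    rw [add_mul]
    split_ifs <;> omega
  · intro k hk
    by_cases hk0 : k = 0
    · exact ⟨0, by rw [hk0, zero_pow hd]⟩
    · rw [hGne k hk0] at hk
      by_contra hcon
      refine hk (Function.extend_apply' _ _ _ ?_)
      rintro ⟨n, hn⟩
      exact hcon ⟨_, hn⟩
  · intro n hn
    rw [hGne _ (pow_ne_zero d (by omega))]
    obtain ⟨i, rfl⟩ := Nat.exists_eq_add_of_le' hn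
    change b (φ i) ≠ 0
    rw [hb, hinj.extend_apply]
    have := hm (i + (m + 1)) (by omega)
    simp only [hw]
    omega
  · rw [hGsum, tsum_congr hext, tsum_extend_zero hinj, ← husum.sum_add_tsum_nat_add m]
    have : ∑' n, u (n + m) = ∑' n, (w n : ℝ) * x ^ φ n := tsum_congr fun n => by
      rw [hshift, hb, hinj.extend_apply]
    rw [this]
    simp only [hu]
    push_cast
    ring

theorem stmt10 (t : ℕ) (ht : 2 ≤ t) (ℓ : ℕ) (hℓ : 2 ≤ ℓ)
    (f : Polynomial ℤ) (hf : 0 < f.leadingCoeff) :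
    (∀ p : Polynomial ℚ, p ≠ 0 →
        Polynomial.aeval
          (∑' n : ℕ, ((f.eval ((n : ℤ) + 1) : ℤ) : ℝ) / t ^ ((n + 1) ^ (ℓ + 1))) p = 0 →
        ℓ + 1 ≤ p.natDegree) ∧
      Irrational (∑' n : ℕ, ((f.eval ((n : ℤ) + 1) : ℤ) : ℝ) / t ^ ((n + 1) ^ (ℓ + 1))) := by
  obtain ⟨G, n₀, r, h0, hgrow, hsupp, hn₀, hlarge, heq⟩ :=
    exists_powerSeries_tsum_eq t ht (ℓ + 1) (Nat.succ_ne_zero ℓ) f hf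
  have hdeg : ∀ p : Polynomial ℚ, p ≠ 0 →
      Polynomial.aeval
        (∑' n : ℕ, ((f.eval ((n : ℤ) + 1) : ℤ) : ℝ) / t ^ ((n + 1) ^ (ℓ + 1))) p = 0 →
      ℓ + 1 ≤ p.natDegree := by
    intro p hp hroot
    by_contra! hlt
    have hp' : p.comp (X + C r) ≠ 0 := fun h => hp (by simpa using (comp_X_add_C_eq_zero_iff).mp h)
    refine aeval_tsum_ne_zero t ht (ℓ + 1) G h0 hgrow hsupp n₀ hn₀ hlarge
      (IsLocalization.integerNormalization (nonZeroDivisors ℤ) (p.comp (X + C r)))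
      (by rwa [Ne, IsLocalization.integerNormalization_eq_zero_iff le_rfl]) ?_
      (IsLocalization.integerNormalization_aeval_eq_zero _ _ ?_)
    · refine (natDegree_le_natDegree
        (degree_mono (IsLocalization.integerNormalization_support _ _))).trans_lt ?_
      rw [natDegree_comp, natDegree_X_add_C, mul_one]
      exact hlt
    · rw [aeval_comp]
      simpa [heq] using hroot
  refine ⟨hdeg, ?_⟩
  rintro ⟨s, hs⟩
  have h := hdeg (X - C s) (X_sub_C_ne_zero s) (by rw [← hs]; simp)
  rw [natDegree_X_sub_C] at h
  omega
end

section
/- Let t ≥ 2 be an integer, ℓ ≥ 2 an integer, and f a polynomial with integer coefficients and positive leading coefficient. Then ∑_{p prime} f(p)/t^{p^ℓ} is either transcendental or algebraic of degree at least ℓ + 1 over ℚ. -/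
open Polynomial

/-- The coefficients of the power series grow at most polynomially. -/
def PolyBounded (F : PowerSeries ℤ) : Prop :=
  ∃ C e : ℕ, ∀ n, |PowerSeries.coeff n F| ≤ (C : ℤ) * ((n : ℤ) + 1) ^ e

/-- The power series has polynomially bounded coefficients and takes the value `s` at `x`. -/
def EvaluatesTo (x : ℝ) (F : PowerSeries ℤ) (s : ℝ) : Prop :=
  PolyBounded F ∧ HasSum (fun n ↦ ((PowerSeries.coeff n F : ℤ) : ℝ) * x ^ n) s

theorem PolyBounded.C (c : ℤ) : PolyBounded (PowerSeries.C c) := by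
  refine ⟨c.natAbs, 0, fun n ↦ ?_⟩
  rw [PowerSeries.coeff_C]
  split_ifs <;> simp

theorem PolyBounded.add {F G : PowerSeries ℤ} (hF : PolyBounded F) (hG : PolyBounded G) :
    PolyBounded (F + G) := by
  obtain ⟨C, e, hC⟩ := hF
  obtain ⟨C', e', hC'⟩ := hG
  refine ⟨C + C', e + e', fun n ↦ ?_⟩
  have h1 : (1 : ℤ) ≤ (n : ℤ) + 1 := by lia
  have h2 : ((n : ℤ) + 1) ^ e ≤ ((n : ℤ) + 1) ^ (e + e') := pow_le_pow_right₀ h1 (by lia)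
  have h3 : ((n : ℤ) + 1) ^ e' ≤ ((n : ℤ) + 1) ^ (e + e') := pow_le_pow_right₀ h1 (by lia)
  rw [map_add]
  push_cast
  calc _ ≤ _ := abs_add_le _ _
    _ ≤ (C : ℤ) * ((n : ℤ) + 1) ^ e + (C' : ℤ) * ((n : ℤ) + 1) ^ e' := add_le_add (hC n) (hC' n)
    _ ≤ (C : ℤ) * ((n : ℤ) + 1) ^ (e + e') + (C' : ℤ) * ((n : ℤ) + 1) ^ (e + e') := by gcongr
    _ = _ := by ring

theorem PolyBounded.mul {F G : PowerSeries ℤ} (hF : PolyBounded F) (hG : PolyBounded G) :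
    PolyBounded (F * G) := by
  obtain ⟨C, e, hC⟩ := hF
  obtain ⟨C', e', hC'⟩ := hG
  refine ⟨C * C', e + e' + 1, fun n ↦ ?_⟩
  rw [PowerSeries.coeff_mul]
  calc _ ≤ ∑ p ∈ Finset.HasAntidiagonal.antidiagonal n, |PowerSeries.coeff p.1 F * PowerSeries.coeff p.2 G| :=
        Finset.abs_sum_le_sum_abs _ _
    _ ≤ ∑ p ∈ Finset.HasAntidiagonal.antidiagonal n,
        ((C : ℤ) * ((n : ℤ) + 1) ^ e) * ((C' : ℤ) * ((n : ℤ) + 1) ^ e') := by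
        refine Finset.sum_le_sum fun p hp ↦ ?_
        have hp' := Finset.HasAntidiagonal.mem_antidiagonal.mp hp
        rw [abs_mul]
        have h1 : (p.1 : ℤ) ≤ n := by lia
        have h2 : (p.2 : ℤ) ≤ n := by lia
        refine mul_le_mul ((hC _).trans ?_) ((hC' _).trans ?_) (abs_nonneg _) (by positivity) <;>
          gcongr
    _ = _ := by
        simp only [Finset.sum_const, Finset.Nat.card_antidiagonal, nsmul_eq_mul]
        push_cast
        ring

theorem summable_succ_pow_mul_geometric {x : ℝ} (hx0 : 0 < x) (hx1 : x < 1) (e : ℕ) :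
    Summable fun n : ℕ ↦ ((n : ℝ) + 1) ^ e * x ^ n := by
  have h := summable_pow_mul_geometric_of_norm_lt_one e
    (show ‖x‖ < 1 by rwa [Real.norm_of_nonneg hx0.le])
  refine (((summable_nat_add_iff 1).mpr h).mul_right x⁻¹).congr fun n ↦ ?_
  have := hx0.ne'
  push_cast
  field_simp
  ring

theorem PolyBounded.summable_norm {F : PowerSeries ℤ} (hF : PolyBounded F) {x : ℝ}
    (hx0 : 0 < x) (hx1 : x < 1) :
    Summable fun n ↦ ‖((PowerSeries.coeff n F : ℤ) : ℝ) * x ^ n‖ := by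
  obtain ⟨C, e, hC⟩ := hF
  refine Summable.of_nonneg_of_le (fun _ ↦ norm_nonneg _) (fun n ↦ ?_)
    ((summable_succ_pow_mul_geometric hx0 hx1 e).mul_left (C : ℝ))
  rw [norm_mul, norm_pow, Real.norm_of_nonneg hx0.le, ← mul_assoc]
  gcongr
  rw [Real.norm_eq_abs]
  exact_mod_cast hC n

theorem EvaluatesTo.mul {x : ℝ} (hx0 : 0 < x) (hx1 : x < 1) {F G : PowerSeries ℤ} {s s' : ℝ}
    (hF : EvaluatesTo x F s) (hG : EvaluatesTo x G s') : EvaluatesTo x (F * G) (s * s') := by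
  refine ⟨hF.1.mul hG.1, ?_⟩
  have h1 := hF.1.summable_norm hx0 hx1
  have h2 := hG.1.summable_norm hx0 hx1
  have h3 := tsum_mul_tsum_eq_tsum_sum_antidiagonal_of_summable_norm h1 h2
  rw [hF.2.tsum_eq, hG.2.tsum_eq] at h3
  rw [h3]
  have key : (fun n ↦ ∑ kl ∈ Finset.HasAntidiagonal.antidiagonal n,
      ((PowerSeries.coeff kl.1 F : ℤ) : ℝ) * x ^ kl.1 *
        (((PowerSeries.coeff kl.2 G : ℤ) : ℝ) * x ^ kl.2)) =
      fun n ↦ ((PowerSeries.coeff n (F * G) : ℤ) : ℝ) * x ^ n := by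
    funext n
    rw [PowerSeries.coeff_mul]
    push_cast
    rw [Finset.sum_mul]
    refine Finset.sum_congr rfl fun p hp ↦ ?_
    rw [← Finset.HasAntidiagonal.mem_antidiagonal.mp hp]
    ring
  rw [key]
  exact ((hF.1.mul hG.1).summable_norm hx0 hx1).of_norm.hasSum

theorem EvaluatesTo.add {x : ℝ} {F G : PowerSeries ℤ} {s s' : ℝ}
    (hF : EvaluatesTo x F s) (hG : EvaluatesTo x G s') : EvaluatesTo x (F + G) (s + s') := by
  refine ⟨hF.1.add hG.1, (hF.2.add hG.2).congr_fun fun n ↦ ?_⟩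
  rw [map_add]
  push_cast
  ring

theorem EvaluatesTo.C (x : ℝ) (c : ℤ) : EvaluatesTo x (PowerSeries.C c) c := by
  refine ⟨PolyBounded.C c, ?_⟩
  convert hasSum_single (f := fun n ↦ ((PowerSeries.coeff n (PowerSeries.C c) : ℤ) : ℝ) * x ^ n)
    0 fun n hn ↦ ?_ using 1
  · simp
  · rw [PowerSeries.coeff_C, if_neg hn, Int.cast_zero, zero_mul]

theorem EvaluatesTo.aeval {x : ℝ} (hx0 : 0 < x) (hx1 : x < 1) {F : PowerSeries ℤ} {s : ℝ}
    (hF : EvaluatesTo x F s) (P : ℤ[X]) :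
    EvaluatesTo x (Polynomial.aeval F P) (Polynomial.aeval s P) := by
  induction P using Polynomial.induction_on with
  | C a => simpa using EvaluatesTo.C x a
  | add p q hp hq => simpa using hp.add hq
  | monomial n a h =>
    rw [pow_succ, ← mul_assoc]
    simpa using h.mul hx0 hx1 hF

/-- A vanishing series whose coefficients have a long enough gap has a vanishing partial sum. -/
theorem EvaluatesTo.sum_range_eq_zero_of_gap {t : ℕ} (ht : 2 ≤ t) {F : PowerSeries ℤ}
    (hF : EvaluatesTo (t : ℝ)⁻¹ F 0) :
    ∃ K N₀ : ℕ, 0 < K ∧ ∀ N ≥ N₀, ∀ R ≤ N,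
      (∀ n, R < n → n ≤ R + K * (Nat.log 2 N + 1) → PowerSeries.coeff n F = 0) →
      ∑ n ∈ Finset.range (R + 1), ((PowerSeries.coeff n F : ℤ) : ℝ) * (t : ℝ)⁻¹ ^ n = 0 := by
  obtain ⟨⟨C, e, hC⟩, hsum⟩ := hF
  have ht0 : (0 : ℝ) < t := by positivity
  set x : ℝ := (t : ℝ)⁻¹ with hx
  have hx0 : 0 < x := by positivity
  have hxt : x * t = 1 := inv_mul_cancel₀ ht0.ne'
  have hx2 : x ≤ 1 / 2 := by
    rw [hx, one_div]
    gcongr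
    exact_mod_cast ht
  have hx1 : x < 1 := by linarith
  have hs := (summable_succ_pow_mul_geometric hx0 hx1 e).mul_left (C : ℝ)
  obtain ⟨M, hM⟩ := exists_nat_ge (∑' n : ℕ, (C : ℝ) * (((n : ℝ) + 1) ^ e * x ^ n))
  refine ⟨e + 1, M * (e + 3) ^ e, e.succ_pos, fun N hN R hR hgap ↦ ?_⟩
  set j := Nat.log 2 N + 1 with hj
  set L := (e + 1) * j with hL
  have hNj : N < 2 ^ j := Nat.lt_pow_succ_log_self (by norm_num) N
  have hbound : M * (R + L + 2) ^ e < 2 ^ L := by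
    have h1 : R + L + 2 ≤ (e + 3) * 2 ^ j := by
      have h2 : j < 2 ^ j := Nat.lt_two_pow_self
      have h3 : (e + 1) * j ≤ (e + 1) * 2 ^ j := by gcongr
      have h4 : 1 ≤ j := by lia
      have : (e + 3) * 2 ^ j = (e + 1) * 2 ^ j + 2 ^ j + 2 ^ j := by ring
      lia
    calc M * (R + L + 2) ^ e ≤ M * ((e + 3) * 2 ^ j) ^ e := by gcongr
      _ = (M * (e + 3) ^ e) * 2 ^ (j * e) := by rw [mul_pow, ← pow_mul]; ring
      _ < 2 ^ j * 2 ^ (j * e) := by gcongr; lia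
      _ = 2 ^ L := by rw [← pow_add, hL]; ring_nf
  set a : ℕ → ℝ := fun n ↦ ((PowerSeries.coeff n F : ℤ) : ℝ) * x ^ n with ha
  have hsplit : ∑ n ∈ Finset.range (R + L + 1), a n = ∑ n ∈ Finset.range (R + 1), a n := by
    symm
    refine Finset.sum_subset (Finset.range_subset_range.mpr (by lia)) fun n hn hn' ↦ ?_
    rw [Finset.mem_range] at hn hn'
    simp [ha, hgap n (by lia) (by lia)]
  have htail : ∑ n ∈ Finset.range (R + 1), a n = - ∑' n, a (n + (R + L + 1)) := by
    have := hsum.summable.sum_add_tsum_nat_add (R + L + 1)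
    rw [hsum.tsum_eq, hsplit] at this
    linarith
  have hle : |∑' n, a (n + (R + L + 1))| ≤ M * ((R + L + 2 : ℕ) : ℝ) ^ e * x ^ (R + L + 1) := by
    have hterm : ∀ n, ‖a (n + (R + L + 1))‖ ≤
        (C : ℝ) * (((n : ℝ) + 1) ^ e * x ^ n) * (((R + L + 2 : ℕ) : ℝ) ^ e * x ^ (R + L + 1)) := by
      intro n
      rw [ha, norm_mul, norm_pow, Real.norm_of_nonneg hx0.le, Real.norm_eq_abs]
      have h1 : |((PowerSeries.coeff (n + (R + L + 1)) F : ℤ) : ℝ)| ≤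
          (C : ℝ) * (((n + (R + L + 1) : ℕ) : ℝ) + 1) ^ e := by exact_mod_cast hC _
      have h2 : ((n + (R + L + 1) : ℕ) : ℝ) + 1 ≤ ((n : ℝ) + 1) * ((R + L + 2 : ℕ) : ℝ) := by
        norm_cast
        nlinarith [Nat.zero_le (n * (R + L + 1))]
      calc _ ≤ (C : ℝ) * (((n : ℝ) + 1) * ((R + L + 2 : ℕ) : ℝ)) ^ e * x ^ (n + (R + L + 1)) := by
            gcongr
            exact h1.trans (by gcongr)
        _ = _ := by rw [mul_pow, pow_add]; ring
    calc _ ≤ _ := tsum_of_norm_bounded (hs.mul_right _).hasSum hterm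
      _ = (∑' n : ℕ, (C : ℝ) * (((n : ℝ) + 1) ^ e * x ^ n)) *
          (((R + L + 2 : ℕ) : ℝ) ^ e * x ^ (R + L + 1)) := tsum_mul_right
      _ ≤ M * (((R + L + 2 : ℕ) : ℝ) ^ e * x ^ (R + L + 1)) := by gcongr
      _ = _ := by ring
  obtain ⟨z, hz⟩ : ∃ z : ℤ, (z : ℝ) = (∑ n ∈ Finset.range (R + 1), a n) * (t : ℝ) ^ R := by
    refine ⟨∑ n ∈ Finset.range (R + 1), PowerSeries.coeff n F * (t : ℤ) ^ (R - n), ?_⟩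
    push_cast
    rw [Finset.sum_mul]
    refine Finset.sum_congr rfl fun n hn ↦ ?_
    have : R = n + (R - n) := by have := Finset.mem_range.mp hn; lia
    rw [ha]
    conv_rhs => rw [this]
    rw [pow_add, mul_assoc, ← mul_assoc (x ^ n), ← mul_pow, hxt, one_pow, one_mul]
  have hz1 : |(z : ℝ)| < 1 := by
    rw [hz, htail, abs_mul, abs_neg, abs_of_nonneg (pow_nonneg ht0.le R)]
    have h1 : (M : ℝ) * ((R + L + 2 : ℕ) : ℝ) ^ e < 2 ^ L := by exact_mod_cast hbound
    have h2 : x ^ (L + 1) ≤ (1 / 2) ^ (L + 1) := by gcongr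
    calc _ ≤ M * ((R + L + 2 : ℕ) : ℝ) ^ e * x ^ (R + L + 1) * (t : ℝ) ^ R := by gcongr
      _ = M * ((R + L + 2 : ℕ) : ℝ) ^ e * x ^ (L + 1) := by
          have h3 : x ^ R * (t : ℝ) ^ R = 1 := by rw [← mul_pow, hxt, one_pow]
          rw [show R + L + 1 = R + (L + 1) by ring, pow_add x R]
          linear_combination (M * ((R + L + 2 : ℕ) : ℝ) ^ e * x ^ (L + 1)) * h3
      _ ≤ 2 ^ L * (1 / 2) ^ (L + 1) := by gcongr
      _ < 1 := by
          rw [pow_succ, ← mul_assoc, ← mul_pow]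
          norm_num
  have hz0 : z = 0 := by
    have : |z| < 1 := by exact_mod_cast hz1
    exact Int.abs_lt_one_iff.mp this
  rw [hz0, Int.cast_zero] at hz
  exact (mul_eq_zero.mp hz.symm).resolve_right (by positivity)

open Classical in
/-- If every element of `B` has `S`-translates at all scales, and no element of `S \ B` is
isolated between two gaps of `S` of length `L`, then `S` meets `[0, N]` in many points. -/
theorem succ_le_mul_card_filter_of_gaps {S B : Set ℕ} {K L N : ℕ} (hL : 0 < L) (hBS : B ⊆ S)
    (h0 : 0 ∈ B)
    (hshift : ∀ m ∈ B, ∀ x, ∃ a, x < a ∧ a ≤ K * (x + 1) ∧ m + a ∈ S)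
    (hgap : ∀ R₁ R₂, R₁ < R₂ → R₂ ≤ N →
      (∀ n, R₁ < n → n ≤ R₁ + L → n ∉ S) → (∀ n, R₂ < n → n ≤ R₂ + L → n ∉ S) →
      (∀ n, R₁ < n → n ≤ R₂ → n ∉ B) → ∀ n, R₁ < n → n ≤ R₂ → n ∉ S) :
    N + 1 ≤ (K + 1) * (L * ((Finset.range (N + 1)).filter (· ∈ S)).card) := by
  set SN := (Finset.range (N + 1)).filter (· ∈ S) with hSN
  set BN := (Finset.range (N + 1)).filter (· ∈ B) with hBN
  set b : ℕ → ℕ := fun n ↦ Nat.findGreatest (· ∈ B) n with hb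
  have hbB : ∀ n, b n ∈ B := fun n ↦
    Nat.findGreatest_spec (P := (· ∈ B)) (Nat.zero_le n) h0
  have hble : ∀ n, b n ≤ n := fun n ↦ Nat.findGreatest_le n
  have hbmax : ∀ n k, b n < k → k ≤ n → k ∉ B := fun n k h1 h2 ↦
    Nat.findGreatest_is_greatest h1 h2
  have hbeq : ∀ n q, b n ≤ q → q ≤ n → b q = b n := by
    intro n q h1 h2
    apply le_antisymm
    · by_contra! h
      exact hbmax n (b q) h ((hble q).trans h2) (hbB q)
    · exact Nat.le_findGreatest h1 (hbB n)
  set cov : ℕ → Prop := fun n ↦ ∃ s ∈ S, s ≤ n ∧ n < s + L with hcov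
  set CN := (Finset.range (N + 1)).filter cov with hCN
  set UN := (Finset.range (N + 1)).filter (fun n ↦ ¬ cov n) with hUN
  have hcard : N + 1 = CN.card + UN.card := by
    rw [hCN, hUN, Finset.card_filter_add_card_filter_not, Finset.card_range]
  have hC : CN.card ≤ L * SN.card := by
    have hsub : CN ⊆ SN.biUnion fun s ↦ Finset.Ico s (s + L) := by
      intro n hn
      obtain ⟨hn, s, hs, hsn, hns⟩ := Finset.mem_filter.mp hn
      rw [Finset.mem_range] at hn
      exact Finset.mem_biUnion.mpr ⟨s, Finset.mem_filter.mpr ⟨Finset.mem_range.mpr (by lia), hs⟩,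
        Finset.mem_Ico.mpr ⟨hsn, hns⟩⟩
    calc _ ≤ _ := Finset.card_le_card hsub
      _ ≤ SN.card * L := Finset.card_biUnion_le_card_mul _ _ _ fun s _ ↦ by simp
      _ = _ := mul_comm _ _
  have hU : UN.card ≤ K * CN.card := by
    have hsub : UN ⊆ BN.biUnion fun m ↦
        Finset.Ico m (m + K * (CN.filter fun q ↦ b q = m).card) := by
      intro n hn
      obtain ⟨hnN, hncov⟩ := Finset.mem_filter.mp hn
      rw [Finset.mem_range] at hnN
      have hLn : ∀ q, ¬ cov q → L ≤ q := by
        intro q hq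
        by_contra! h
        exact hq ⟨0, hBS h0, by lia, by lia⟩
      have hfree : ∀ q, ¬ cov q → ∀ k, q - L < k → k ≤ (q - L) + L → k ∉ S := by
        intro q hq k h1 h2 hk
        have := hLn q hq
        exact hq ⟨k, hk, by lia, by lia⟩
      set s := Nat.findGreatest (· ∈ S) n with hs
      have hsS : s ∈ S := Nat.findGreatest_spec (P := (· ∈ S)) (Nat.zero_le n) (hBS h0)
      have hsn : s ≤ n := Nat.findGreatest_le n
      have hsmax : ∀ k, s < k → k ≤ n → k ∉ S := fun k h1 h2 ↦ Nat.findGreatest_is_greatest h1 h2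
      have hbs : b n ≤ s := Nat.le_findGreatest (hble n) (hBS (hbB n))
      have hsL : s + L ≤ n := by
        by_contra! h
        exact hncov ⟨s, hsS, hsn, h⟩
      have hall : ∀ q, b n ≤ q → q ≤ s → cov q := by
        intro q h1 h2
        by_contra hq
        have hLq := hLn q hq
        have hbq : b n ≤ q - L := by
          by_contra! h
          exact hfree q hq (b n) h (by lia) (hBS (hbB n))
        exact hgap (q - L) (n - L) (by lia) (by lia) (hfree q hq) (hfree n hncov)
          (fun k h3 h4 ↦ hbmax n k (by lia) (by lia)) s (by lia) (by lia) hsS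
      have hfib : s - b n + 1 ≤ (CN.filter fun q ↦ b q = b n).card := by
        have hsub : Finset.Icc (b n) s ⊆ CN.filter fun q ↦ b q = b n := by
          intro q hq
          obtain ⟨h1, h2⟩ := Finset.mem_Icc.mp hq
          exact Finset.mem_filter.mpr ⟨Finset.mem_filter.mpr
            ⟨Finset.mem_range.mpr (by lia), hall q h1 h2⟩, hbeq n q h1 (h2.trans hsn)⟩
        have := Finset.card_le_card hsub
        rw [Nat.card_Icc] at this
        lia
      obtain ⟨a, ha1, ha2, ha3⟩ := hshift (b n) (hbB n) (s - b n)
      have han : n < b n + a := by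
        by_contra! h
        exact hsmax (b n + a) (by lia) h ha3
      refine Finset.mem_biUnion.mpr ⟨b n, Finset.mem_filter.mpr
        ⟨Finset.mem_range.mpr ((hble n).trans_lt hnN), hbB n⟩, Finset.mem_Ico.mpr ⟨hble n, ?_⟩⟩
      calc n < b n + a := han
        _ ≤ b n + K * (s - b n + 1) := by gcongr
        _ ≤ _ := by gcongr
    have hmaps : ∀ q ∈ CN, b q ∈ BN := by
      intro q hq
      have := Finset.mem_range.mp (Finset.mem_filter.mp hq).1
      exact Finset.mem_filter.mpr ⟨Finset.mem_range.mpr ((hble q).trans_lt this), hbB q⟩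
    calc _ ≤ _ := Finset.card_le_card hsub
      _ ≤ ∑ m ∈ BN, (Finset.Ico m (m + K * (CN.filter fun q ↦ b q = m).card)).card :=
          Finset.card_biUnion_le
      _ = K * ∑ m ∈ BN, (CN.filter fun q ↦ b q = m).card := by simp [Finset.mul_sum]
      _ = K * CN.card := by rw [← Finset.card_eq_sum_card_fiberwise hmaps]
  calc N + 1 = CN.card + UN.card := hcard
    _ ≤ CN.card + K * CN.card := by gcongr
    _ = (K + 1) * CN.card := by ring
    _ ≤ _ := by gcongr

theorem PowerSeries.coeff_pow_nonneg {W : PowerSeries ℤ} (hW : ∀ n, 0 ≤ PowerSeries.coeff n W)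
    (d n : ℕ) : 0 ≤ PowerSeries.coeff n (W ^ d) := by
  induction d generalizing n with
  | zero => rw [pow_zero, PowerSeries.coeff_one]; split_ifs <;> simp
  | succ d ih =>
    rw [pow_succ, PowerSeries.coeff_mul]
    exact Finset.sum_nonneg fun p _ ↦ mul_nonneg (ih _) (hW _)

theorem PowerSeries.coeff_pow_succ_ne_zero {W : PowerSeries ℤ}
    (hW : ∀ n, 0 ≤ PowerSeries.coeff n W) {d m a : ℕ} (hm : PowerSeries.coeff m (W ^ d) ≠ 0)
    (ha : PowerSeries.coeff a W ≠ 0) : PowerSeries.coeff (m + a) (W ^ (d + 1)) ≠ 0 := by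
  rw [pow_succ, PowerSeries.coeff_mul]
  refine (Finset.sum_pos' (fun p _ ↦ mul_nonneg (PowerSeries.coeff_pow_nonneg hW _ _) (hW _))
    ⟨(m, a), Finset.HasAntidiagonal.mem_antidiagonal.mpr rfl, ?_⟩).ne'
  exact mul_pos ((PowerSeries.coeff_pow_nonneg hW _ _).lt_of_ne' hm) ((hW a).lt_of_ne' ha)

theorem PowerSeries.card_support_pow_le (W : PowerSeries ℤ) (d N : ℕ) :
    ((Finset.range (N + 1)).filter fun n ↦ PowerSeries.coeff n (W ^ d) ≠ 0).card ≤
      ((Finset.range (N + 1)).filter fun n ↦ PowerSeries.coeff n W ≠ 0).card ^ d := by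
  induction d with
  | zero =>
    rw [pow_zero, pow_zero]
    refine Finset.card_le_one.mpr fun a ha b hb ↦ ?_
    simp only [PowerSeries.coeff_one, Finset.mem_filter, ne_eq, ite_eq_right_iff, one_ne_zero,
      imp_false, not_not] at ha hb
    rw [ha.2, hb.2]
  | succ d ih =>
    rw [pow_succ (Finset.card _)]
    refine le_trans ?_ (Nat.mul_le_mul_right _ ih)
    refine le_trans (Finset.card_le_card ?_) (Finset.card_image₂_le (· + ·) _ _)
    intro n hn
    obtain ⟨hn, hne⟩ := Finset.mem_filter.mp hn
    rw [Finset.mem_range] at hn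
    rw [pow_succ, PowerSeries.coeff_mul] at hne
    obtain ⟨p, hp, hp0⟩ := Finset.exists_ne_zero_of_sum_ne_zero hne
    have hpn := Finset.HasAntidiagonal.mem_antidiagonal.mp hp
    refine Finset.mem_image₂.mpr ⟨p.1, ?_, p.2, ?_, hpn⟩ <;>
      refine Finset.mem_filter.mpr ⟨Finset.mem_range.mpr (by lia), ?_⟩
    · exact left_ne_zero_of_mul hp0
    · exact right_ne_zero_of_mul hp0

open Classical in
theorem PowerSeries.card_support_pow_le_le (W : PowerSeries ℤ) (D N : ℕ) :
    ((Finset.range (N + 1)).filter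
      (· ∈ {n | ∃ d ≤ D, PowerSeries.coeff n (W ^ d) ≠ 0})).card ≤
      (D + 1) * (((Finset.range (N + 1)).filter fun n ↦ PowerSeries.coeff n W ≠ 0).card + 1) ^ D
      := by
  set k := ((Finset.range (N + 1)).filter fun n ↦ PowerSeries.coeff n W ≠ 0).card
  have hsub : (Finset.range (N + 1)).filter
      (· ∈ {n | ∃ d ≤ D, PowerSeries.coeff n (W ^ d) ≠ 0}) ⊆
      (Finset.range (D + 1)).biUnion fun d ↦
        (Finset.range (N + 1)).filter fun n ↦ PowerSeries.coeff n (W ^ d) ≠ 0 := by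
    intro n hn
    obtain ⟨hn, d, hd, hne⟩ := Finset.mem_filter.mp hn
    exact Finset.mem_biUnion.mpr ⟨d, Finset.mem_range.mpr (by lia), Finset.mem_filter.mpr ⟨hn, hne⟩⟩
  refine (Finset.card_le_card hsub).trans ((Finset.card_biUnion_le_card_mul _ _ ((k + 1) ^ D)
    fun d hd ↦ ?_).trans (by rw [Finset.card_range]))
  have hd' := Finset.mem_range.mp hd
  calc _ ≤ k ^ d := PowerSeries.card_support_pow_le W d N
    _ ≤ (k + 1) ^ d := by gcongr; lia
    _ ≤ (k + 1) ^ D := Nat.pow_le_pow_right (by lia) (by lia)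

/-- A power series with nonnegative, polynomially bounded coefficients, supported on a set that is
syndetic on the multiplicative scale and sparse enough along a sequence, takes at `1 / t` a value
which is not a root of a nonzero polynomial of degree at most `ℓ`. -/
theorem EvaluatesTo.eq_zero_of_aeval_eq_zero {t : ℕ} (ht : 2 ≤ t) {W : PowerSeries ℤ} {s : ℝ}
    (hs : EvaluatesTo (t : ℝ)⁻¹ W s) (hW : ∀ n, 0 ≤ PowerSeries.coeff n W) {K ℓ : ℕ}
    (hK : ∀ x, ∃ a, x < a ∧ a ≤ K * (x + 1) ∧ PowerSeries.coeff a W ≠ 0)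
    (hcount : ∀ K N₀ : ℕ, ∃ N ≥ N₀, K * (Nat.log 2 N + 1) *
      (((Finset.range (N + 1)).filter fun n ↦ PowerSeries.coeff n W ≠ 0).card + 1) ^ ℓ ≤ N)
    {P : ℤ[X]} (hdeg : P.natDegree ≤ ℓ) (hP : Polynomial.aeval s P = 0) : P = 0 := by
  classical
  by_contra hP0
  have ht0 : (0 : ℝ) < t := by positivity
  set x : ℝ := (t : ℝ)⁻¹ with hx
  have hx0 : 0 < x := by positivity
  have hx1 : x < 1 := inv_lt_one_of_one_lt₀ (by exact_mod_cast ht)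
  set D := P.natDegree with hD
  have hDpos : 0 < D := by
    by_contra! h
    rw [Polynomial.eq_C_of_natDegree_eq_zero (show P.natDegree = 0 by lia)] at hP hP0
    simp only [eq_intCast, map_intCast, Int.cast_eq_zero] at hP
    exact hP0 (by rw [hP, Polynomial.C_0])
  set F := Polynomial.aeval W P with hF
  have hcoeff : ∀ n, PowerSeries.coeff n F =
      ∑ d ∈ Finset.range (D + 1), P.coeff d * PowerSeries.coeff n (W ^ d) := by
    intro n
    rw [hF, Polynomial.aeval_eq_sum_range, map_sum]
    simp [hD]
  have hFe : EvaluatesTo x F 0 := hP ▸ hs.aeval hx0 hx1 P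
  obtain ⟨K₁, N₀, hK₁, hgap⟩ := hFe.sum_range_eq_zero_of_gap ht
  obtain ⟨N, hN, hNle⟩ := hcount ((K + 1) * K₁ * (D + 1)) N₀
  set k := ((Finset.range (N + 1)).filter fun n ↦ PowerSeries.coeff n W ≠ 0).card
  set L := K₁ * (Nat.log 2 N + 1) with hL
  have hzero : ∀ n, n ∉ {n | ∃ d ≤ D, PowerSeries.coeff n (W ^ d) ≠ 0} →
      PowerSeries.coeff n F = 0 := by
    intro n hn
    simp only [Set.mem_ofPred_eq, not_exists, not_and, not_not] at hn
    rw [hcoeff]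
    refine Finset.sum_eq_zero fun d hd ↦ ?_
    rw [hn d (by have := Finset.mem_range.mp hd; lia), mul_zero]
  have key := succ_le_mul_card_filter_of_gaps
    (S := {n | ∃ d ≤ D, PowerSeries.coeff n (W ^ d) ≠ 0})
    (B := {n | ∃ d < D, PowerSeries.coeff n (W ^ d) ≠ 0}) (K := K) (L := L) (N := N)
    (by positivity) (fun n ⟨d, hd, h⟩ ↦ ⟨d, hd.le, h⟩) ⟨0, hDpos, by simp⟩ ?_ ?_
  · have h1 : _ ≤ (D + 1) * (k + 1) ^ D := PowerSeries.card_support_pow_le_le W D N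
    have h2 : (k + 1) ^ D ≤ (k + 1) ^ ℓ := Nat.pow_le_pow_right (by lia) hdeg
    have h3 : N + 1 ≤ N := by
      calc N + 1 ≤ _ := key
        _ ≤ (K + 1) * (L * ((D + 1) * (k + 1) ^ D)) :=
          Nat.mul_le_mul_left _ (Nat.mul_le_mul_left _ (le_trans (by congr!) h1))
        _ ≤ (K + 1) * (L * ((D + 1) * (k + 1) ^ ℓ)) := by gcongr
        _ = (K + 1) * K₁ * (D + 1) * (Nat.log 2 N + 1) * (k + 1) ^ ℓ := by rw [hL]; ring
        _ ≤ N := hNle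
    lia
  · rintro m ⟨d, hd, hm⟩ y
    obtain ⟨a, h1, h2, h3⟩ := hK y
    exact ⟨a, h1, h2, d + 1, hd, PowerSeries.coeff_pow_succ_ne_zero hW hm h3⟩
  · intro R₁ R₂ hR hRN hfree₁ hfree₂ hB n hn1 hn2 ⟨d, hd, hne⟩
    have e1 := hgap N hN R₁ (by lia) fun n h1 h2 ↦ hzero n (hfree₁ n h1 h2)
    have e2 := hgap N hN R₂ hRN fun n h1 h2 ↦ hzero n (hfree₂ n h1 h2)
    have hdD : d = D := by
      by_contra h
      exact hB n hn1 hn2 ⟨d, by lia, hne⟩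
    subst hdD
    have hsum : ∑ n ∈ Finset.Ico (R₁ + 1) (R₂ + 1),
        ((PowerSeries.coeff n F : ℤ) : ℝ) * x ^ n = 0 := by
      rw [Finset.sum_Ico_eq_sub _ (by lia), e1, e2, sub_zero]
    have hterm : ∀ n ∈ Finset.Ico (R₁ + 1) (R₂ + 1),
        ((PowerSeries.coeff n F : ℤ) : ℝ) * x ^ n =
        (P.leadingCoeff : ℝ) * (((PowerSeries.coeff n (W ^ D) : ℤ) : ℝ) * x ^ n) := by
      intro n hn
      obtain ⟨h1, h2⟩ := Finset.mem_Ico.mp hn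
      have hnB := hB n (by lia) (by lia)
      simp only [Set.mem_ofPred_eq, not_exists, not_and, not_not] at hnB
      rw [hcoeff, Finset.sum_range_succ, Finset.sum_eq_zero, zero_add, Polynomial.leadingCoeff,
        Int.cast_mul, mul_assoc]
      intro d hd
      rw [hnB d (Finset.mem_range.mp hd), mul_zero]
    rw [Finset.sum_congr rfl hterm, ← Finset.mul_sum] at hsum
    have hlead : (P.leadingCoeff : ℝ) ≠ 0 := by
      exact_mod_cast Polynomial.leadingCoeff_ne_zero.mpr hP0
    have h4 := (Finset.sum_eq_zero_iff_of_nonneg fun i _ ↦ mul_nonneg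
      (by exact_mod_cast PowerSeries.coeff_pow_nonneg hW D i) (by positivity)).mp
      ((mul_eq_zero.mp hsum).resolve_left hlead) n (Finset.mem_Ico.mpr ⟨by lia, by lia⟩)
    have h5 := (mul_eq_zero.mp h4).resolve_right (by positivity)
    exact hne (by exact_mod_cast h5)

theorem Polynomial.exists_abs_eval_natCast_le (f : ℤ[X]) :
    ∃ C e : ℕ, ∀ n : ℕ, |f.eval (n : ℤ)| ≤ (C : ℤ) * ((n : ℤ) + 1) ^ e := by
  refine ⟨∑ i ∈ Finset.range (f.natDegree + 1), (f.coeff i).natAbs, f.natDegree, fun n ↦ ?_⟩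
  rw [Polynomial.eval_eq_sum_range]
  push_cast
  rw [Finset.sum_mul]
  refine (Finset.abs_sum_le_sum_abs _ _).trans (Finset.sum_le_sum fun i hi ↦ ?_)
  rw [abs_mul, abs_pow, Nat.abs_cast]
  have hi' : i ≤ f.natDegree := by have := Finset.mem_range.mp hi; lia
  gcongr
  calc (n : ℤ) ^ i ≤ ((n : ℤ) + 1) ^ i := by gcongr; lia
    _ ≤ _ := pow_le_pow_right₀ (by lia) hi'

theorem Polynomial.exists_forall_eval_natCast_pos {f : ℤ[X]} (hf : 0 < f.leadingCoeff) :
    ∃ B : ℕ, 0 < B ∧ ∀ n ≥ B, 0 < f.eval (n : ℤ) := by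
  set g := f.map (Int.castRingHom ℝ) with hg
  have hlead : 0 < g.leadingCoeff := by
    rw [hg, Polynomial.leadingCoeff_map_of_injective Int.cast_injective]
    exact Int.cast_pos.mpr hf
  have heval : ∀ n : ℕ, g.eval (n : ℝ) = ((f.eval (n : ℤ) : ℤ) : ℝ) := by
    intro n
    rw [hg, show (n : ℝ) = Int.castRingHom ℝ (n : ℤ) by simp, Polynomial.eval_map_apply]
    simp
  have hev : ∀ᶠ y in Filter.atTop, 0 < g.eval y := by
    by_cases hdeg : 0 < g.degree
    · exact (g.tendsto_atTop_of_leadingCoeff_nonneg hdeg hlead.le).eventually_gt_atTop 0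
    · rw [Polynomial.eq_C_of_degree_le_zero (not_lt.mp hdeg), Polynomial.leadingCoeff_C] at hlead
      rw [Polynomial.eq_C_of_degree_le_zero (not_lt.mp hdeg)]
      simp [hlead]
  obtain ⟨B, hB⟩ := Filter.eventually_atTop.mp (tendsto_natCast_atTop_atTop.eventually hev)
  refine ⟨B + 1, B.succ_pos, fun n hn ↦ ?_⟩
  have := hB n (by lia)
  rw [heval] at this
  exact_mod_cast this

theorem exists_mul_primeCounting_two_pow_le :
    ∃ C m₀ : ℕ, ∀ m ≥ m₀, m * (Nat.primeCounting (2 ^ m) + 1) ≤ C * 2 ^ m := by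
  have h := (tendsto_natCast_atTop_atTop (R := ℝ)).comp
    (tendsto_pow_atTop_atTop_of_one_lt (one_lt_two : (1 : ℕ) < 2))
  obtain ⟨m₀, hm₀⟩ := Filter.eventually_atTop.mp
    (h.eventually (Chebyshev.eventually_primeCounting_le one_pos))
  obtain ⟨C, hC⟩ := exists_nat_ge ((Real.log 4 + 1) / Real.log 2)
  refine ⟨C + 1, max m₀ 1, fun m hm ↦ ?_⟩
  have h1 := hm₀ m (le_of_max_le_left hm)
  have hm1 : (0 : ℝ) < m := by exact_mod_cast le_of_max_le_right hm
  have hl2 : 0 < Real.log 2 := Real.log_pos one_lt_two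
  simp only [Function.comp_apply, Nat.floor_natCast] at h1
  simp only [Nat.cast_pow, Nat.cast_ofNat, Real.log_pow] at h1
  have h2 : (m : ℝ) * (Nat.primeCounting (2 ^ m) : ℝ) ≤ C * 2 ^ m := by
    calc (m : ℝ) * (Nat.primeCounting (2 ^ m) : ℝ)
        ≤ m * ((Real.log 4 + 1) * 2 ^ m / (m * Real.log 2)) := by gcongr
      _ = (Real.log 4 + 1) / Real.log 2 * 2 ^ m := by field_simp
      _ ≤ _ := by gcongr
  have h3 : m * Nat.primeCounting (2 ^ m) ≤ C * 2 ^ m := by exact_mod_cast h2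
  have h4 : m < 2 ^ m := Nat.lt_two_pow_self
  calc _ = m * Nat.primeCounting (2 ^ m) + m := by ring
    _ ≤ C * 2 ^ m + 2 ^ m := by lia
    _ = _ := by ring

theorem exists_mul_log_mul_primeCounting_pow_le {ℓ : ℕ} (hℓ : 2 ≤ ℓ) (K N₀ : ℕ) :
    ∃ M, N₀ ≤ M ^ ℓ ∧
      K * (Nat.log 2 (M ^ ℓ) + 1) * (Nat.primeCounting M + 1) ^ ℓ ≤ M ^ ℓ := by
  obtain ⟨C, m₀, hC⟩ := exists_mul_primeCounting_two_pow_le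
  set m := max (max m₀ N₀) (2 * K * ℓ * C ^ ℓ + 1) with hm
  have hm1 : m₀ ≤ m := (le_max_left _ _).trans (le_max_left _ _)
  have hm2 : N₀ ≤ m := (le_max_right _ _).trans (le_max_left _ _)
  have hm3 : 2 * K * ℓ * C ^ ℓ + 1 ≤ m := le_max_right _ _
  refine ⟨2 ^ m, ?_, ?_⟩
  · calc N₀ ≤ m := hm2
      _ ≤ 2 ^ m := Nat.lt_two_pow_self.le
      _ ≤ _ := Nat.le_self_pow (by lia) _
  · have hlog : Nat.log 2 ((2 ^ m) ^ ℓ) = m * ℓ := by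
      rw [← pow_mul, Nat.log_pow (by norm_num)]
    rw [hlog]
    have hmpos : 0 < m ^ ℓ := by
      have : 0 < m := by lia
      positivity
    refine Nat.le_of_mul_le_mul_left ?_ hmpos
    have hml : m * ℓ + 1 ≤ 2 * (m * ℓ) := by
      have : 0 < m * ℓ := Nat.mul_pos (by lia) (by lia)
      lia
    calc m ^ ℓ * (K * (m * ℓ + 1) * (Nat.primeCounting (2 ^ m) + 1) ^ ℓ)
        = K * (m * ℓ + 1) * (m * (Nat.primeCounting (2 ^ m) + 1)) ^ ℓ := by rw [mul_pow]; ring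
      _ ≤ K * (2 * (m * ℓ)) * (C * 2 ^ m) ^ ℓ := by
          have := hC m hm1
          gcongr ?_ * ?_ ^ ℓ
          exact Nat.mul_le_mul_left _ hml
      _ = m * (2 * K * ℓ * C ^ ℓ) * (2 ^ m) ^ ℓ := by rw [mul_pow]; ring
      _ ≤ m * m * (2 ^ m) ^ ℓ := by gcongr; lia
      _ = m ^ 2 * (2 ^ m) ^ ℓ := by ring
      _ ≤ m ^ ℓ * (2 ^ m) ^ ℓ := by
          gcongr
          lia

theorem exists_prime_pow_between {B ℓ : ℕ} (hB : 0 < B) (hℓ : ℓ ≠ 0) (x : ℕ) :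
    ∃ p, p.Prime ∧ B ≤ p ∧ x < p ^ ℓ ∧ p ^ ℓ ≤ (4 * B) ^ ℓ * (x + 1) := by
  have hex : ∃ y, x < y ^ ℓ := ⟨x + 1, (Nat.lt_succ_self x).trans_le (Nat.le_self_pow hℓ _)⟩
  classical
  obtain ⟨y, hy, hmin⟩ : ∃ y, x < y ^ ℓ ∧ ∀ z < y, z ^ ℓ ≤ x :=
    ⟨Nat.find hex, Nat.find_spec hex, fun z hz ↦ not_lt.mp (Nat.find_min hex hz)⟩
  have hy0 : 0 < y := by
    by_contra! h
    rw [Nat.le_zero.mp h, zero_pow hℓ] at hy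
    lia
  have hyle : y ^ ℓ ≤ 2 ^ ℓ * (x + 1) := by
    rcases Nat.lt_or_ge 1 y with h | h
    · calc y ^ ℓ ≤ (2 * (y - 1)) ^ ℓ := by gcongr; lia
        _ = 2 ^ ℓ * (y - 1) ^ ℓ := mul_pow _ _ _
        _ ≤ 2 ^ ℓ * (x + 1) := by
          gcongr
          exact (hmin (y - 1) (by lia)).trans (by lia)
    · rw [show y = 1 by lia, one_pow]
      exact Nat.mul_pos (by positivity) (by lia)
  have hyB : y ≤ y * B := Nat.le_mul_of_pos_right y hB
  have hBy : B ≤ y * B := Nat.le_mul_of_pos_left B hy0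
  obtain ⟨p, hp, hp1, hp2⟩ := Nat.exists_prime_lt_and_le_two_mul (y * B) (by positivity)
  refine ⟨p, hp, by lia, hy.trans_le (by gcongr; lia), ?_⟩
  calc p ^ ℓ ≤ (2 * (y * B)) ^ ℓ := by gcongr
    _ = (2 * B) ^ ℓ * y ^ ℓ := by rw [← mul_pow]; ring
    _ ≤ (2 * B) ^ ℓ * (2 ^ ℓ * (x + 1)) := by gcongr
    _ = _ := by rw [← mul_assoc, ← mul_pow]; ring

/-- The power series with coefficient `f p` at `p ^ ℓ` for the primes `p ≥ B`. -/
noncomputable def primePowSeries (f : ℤ[X]) (ℓ B : ℕ) : PowerSeries ℤ :=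
  PowerSeries.mk (Function.extend (fun q : {p : ℕ // p.Prime ∧ B ≤ p} ↦ (q : ℕ) ^ ℓ)
    (fun q ↦ f.eval ((q : ℕ) : ℤ)) 0)

theorem primePow_injective {ℓ : ℕ} (hℓ : ℓ ≠ 0) (B : ℕ) :
    Function.Injective (fun q : {p : ℕ // p.Prime ∧ B ≤ p} ↦ (q : ℕ) ^ ℓ) :=
  fun _ _ h ↦ Subtype.ext (Nat.pow_left_injective hℓ h)

theorem coeff_primePowSeries_pow (f : ℤ[X]) {ℓ : ℕ} (hℓ : ℓ ≠ 0) {B p : ℕ} (hp : p.Prime)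
    (hB : B ≤ p) : PowerSeries.coeff (p ^ ℓ) (primePowSeries f ℓ B) = f.eval (p : ℤ) := by
  rw [primePowSeries, PowerSeries.coeff_mk]
  exact (primePow_injective hℓ B).extend_apply _ _ (⟨p, hp, hB⟩ : {p : ℕ // p.Prime ∧ B ≤ p})

theorem exists_eq_pow_of_coeff_primePowSeries_ne_zero {f : ℤ[X]} {ℓ B n : ℕ}
    (h : PowerSeries.coeff n (primePowSeries f ℓ B) ≠ 0) :
    ∃ p : ℕ, p.Prime ∧ B ≤ p ∧ p ^ ℓ = n := by
  by_contra! hn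
  rw [primePowSeries, PowerSeries.coeff_mk, Function.extend_apply'] at h
  · exact h rfl
  · rintro ⟨q, hq⟩
    exact hn q q.2.1 q.2.2 hq

theorem coeff_primePowSeries_nonneg {f : ℤ[X]} {ℓ B : ℕ} (hℓ : ℓ ≠ 0)
    (hpos : ∀ n ≥ B, 0 < f.eval (n : ℤ)) (n : ℕ) :
    0 ≤ PowerSeries.coeff n (primePowSeries f ℓ B) := by
  by_contra! h
  obtain ⟨p, hp, hB, rfl⟩ := exists_eq_pow_of_coeff_primePowSeries_ne_zero h.ne
  rw [coeff_primePowSeries_pow f hℓ hp hB] at h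
  exact h.not_gt (hpos p hB)

theorem polyBounded_primePowSeries (f : ℤ[X]) {ℓ : ℕ} (hℓ : ℓ ≠ 0) (B : ℕ) :
    PolyBounded (primePowSeries f ℓ B) := by
  obtain ⟨C, e, hC⟩ := f.exists_abs_eval_natCast_le
  refine ⟨C, e, fun n ↦ ?_⟩
  by_cases h : PowerSeries.coeff n (primePowSeries f ℓ B) = 0
  · rw [h, abs_zero]
    positivity
  · obtain ⟨p, hp, hB, rfl⟩ := exists_eq_pow_of_coeff_primePowSeries_ne_zero h
    rw [coeff_primePowSeries_pow f hℓ hp hB]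
    refine (hC p).trans ?_
    have : p ≤ p ^ ℓ := Nat.le_self_pow hℓ p
    gcongr

theorem evaluatesTo_primePowSeries (f : ℤ[X]) {ℓ : ℕ} (hℓ : ℓ ≠ 0) (B : ℕ) {x : ℝ} (hx0 : 0 < x)
    (hx1 : x < 1) :
    Summable (fun q : {p : ℕ // p.Prime ∧ B ≤ p} ↦
      ((f.eval ((q : ℕ) : ℤ) : ℤ) : ℝ) * x ^ ((q : ℕ) ^ ℓ)) ∧
    EvaluatesTo x (primePowSeries f ℓ B) (∑' q : {p : ℕ // p.Prime ∧ B ≤ p},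
      ((f.eval ((q : ℕ) : ℤ) : ℤ) : ℝ) * x ^ ((q : ℕ) ^ ℓ)) := by
  have hb := polyBounded_primePowSeries f hℓ B
  have hsum := (hb.summable_norm hx0 hx1).of_norm.hasSum
  have hsub := (Function.Injective.hasSum_iff (primePow_injective hℓ B)
    (f := fun n ↦ ((PowerSeries.coeff n (primePowSeries f ℓ B) : ℤ) : ℝ) * x ^ n) fun n hn ↦ ?_).mpr
    hsum
  · have hfun : ((fun n ↦ ((PowerSeries.coeff n (primePowSeries f ℓ B) : ℤ) : ℝ) * x ^ n) ∘
        fun q : {p : ℕ // p.Prime ∧ B ≤ p} ↦ (q : ℕ) ^ ℓ) =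
        fun q : {p : ℕ // p.Prime ∧ B ≤ p} ↦
          ((f.eval ((q : ℕ) : ℤ) : ℤ) : ℝ) * x ^ ((q : ℕ) ^ ℓ) := by
      funext q
      simp only [Function.comp_apply]
      rw [coeff_primePowSeries_pow f hℓ q.2.1 q.2.2]
    rw [hfun] at hsub
    exact ⟨hsub.summable, hb, by rw [hsub.tsum_eq]; exact hsum⟩
  · by_contra h
    obtain ⟨p, hp, hB, rfl⟩ := exists_eq_pow_of_coeff_primePowSeries_ne_zero (f := f) (ℓ := ℓ)
      (B := B) (n := n) fun h0 ↦ h (by rw [h0, Int.cast_zero, zero_mul])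
    exact hn ⟨⟨p, hp, hB⟩, rfl⟩

theorem card_support_primePowSeries_le (f : ℤ[X]) {ℓ : ℕ} (hℓ : ℓ ≠ 0) (B M : ℕ) :
    ((Finset.range (M ^ ℓ + 1)).filter
      fun n ↦ PowerSeries.coeff n (primePowSeries f ℓ B) ≠ 0).card ≤ Nat.primeCounting M := by
  rw [Nat.primeCounting, Nat.primeCounting', Nat.count_eq_card_filter_range]
  refine le_trans (Finset.card_le_card ?_)
    (Finset.card_image_le (f := fun p ↦ p ^ ℓ))
  intro n hn
  obtain ⟨hn, hne⟩ := Finset.mem_filter.mp hn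
  obtain ⟨p, hp, -, rfl⟩ := exists_eq_pow_of_coeff_primePowSeries_ne_zero hne
  have hpM : p ≤ M := by
    have := Finset.mem_range.mp hn
    exact (Nat.pow_le_pow_iff_left hℓ).mp (by lia)
  exact Finset.mem_image.mpr ⟨p, Finset.mem_filter.mpr ⟨Finset.mem_range.mpr (by lia), hp⟩, rfl⟩

theorem exists_rat_add_tsum_primes_ge (f : ℤ[X]) {t : ℕ} (ht : 2 ≤ t) {ℓ : ℕ} (hℓ : ℓ ≠ 0)
    (B : ℕ) :
    ∃ r : ℚ, (∑' q : {p : ℕ // p.Prime}, ((f.eval ((q : ℕ) : ℤ) : ℤ) : ℝ) / t ^ ((q : ℕ) ^ ℓ)) =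
      r + ∑' q : {p : ℕ // p.Prime ∧ B ≤ p},
        ((f.eval ((q : ℕ) : ℤ) : ℤ) : ℝ) * (t : ℝ)⁻¹ ^ ((q : ℕ) ^ ℓ) := by
  classical
  have ht0 : (0 : ℝ) < t := by positivity
  have hx1 : (t : ℝ)⁻¹ < 1 := inv_lt_one_of_one_lt₀ (by exact_mod_cast ht)
  set g : ℕ → ℝ := fun n ↦ ((f.eval (n : ℤ) : ℤ) : ℝ) * (t : ℝ)⁻¹ ^ (n ^ ℓ) with hg
  have hs := (evaluatesTo_primePowSeries f hℓ B (inv_pos.mpr ht0) hx1).1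
  set s₁ : Set ℕ := {n | n.Prime ∧ n < B} with hs₁
  set s₂ : Set ℕ := {n | n.Prime ∧ B ≤ n} with hs₂
  have hfin : s₁.Finite := (Set.finite_lt_nat B).subset fun n hn ↦ hn.2
  have hdisj : Disjoint s₁ s₂ := Set.disjoint_left.mpr fun n h1 h2 ↦ h1.2.not_ge h2.2
  have hunion : {n : ℕ | n.Prime} = s₁ ∪ s₂ := by
    ext n
    exact ⟨fun h ↦ (lt_or_ge n B).imp (fun h' ↦ ⟨h, h'⟩) (fun h' ↦ ⟨h, h'⟩),
      fun h ↦ h.elim And.left And.left⟩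
  have hfs : Summable (g ∘ ((↑) : s₁ → ℕ)) := by
    have := hfin.fintype
    exact (hasSum_fintype _).summable
  have hsplit : ∑' q : {n : ℕ | n.Prime}, g q = ∑' q : s₁, g q + ∑' q : s₂, g q := by
    rw [hunion]
    exact hfs.tsum_union_disjoint hdisj hs
  refine ⟨∑ n ∈ hfin.toFinset, ((f.eval (n : ℤ) : ℤ) : ℚ) * (t : ℚ)⁻¹ ^ (n ^ ℓ), ?_⟩
  have h1 : ∑' q : s₁, g q = ∑ n ∈ hfin.toFinset, g n := by
    rw [← Finset.tsum_subtype' hfin.toFinset g, hfin.coe_toFinset]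
  have h2 : (∑' q : {p : ℕ // p.Prime},
      ((f.eval ((q : ℕ) : ℤ) : ℤ) : ℝ) / t ^ ((q : ℕ) ^ ℓ)) = ∑' q : {n : ℕ | n.Prime}, g q := by
    refine tsum_congr fun q ↦ ?_
    simp only [hg, div_eq_mul_inv, inv_pow]
  rw [h2, hsplit, h1]
  push_cast
  rfl

theorem stmt11 (t : ℕ) (ht : 2 ≤ t) (ℓ : ℕ) (hℓ : 2 ≤ ℓ)
    (f : Polynomial ℤ) (hf : 0 < f.leadingCoeff) :
    ∀ p : Polynomial ℚ, p ≠ 0 →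
      Polynomial.aeval
        (∑' q : {p : ℕ // p.Prime}, ((f.eval ((q : ℕ) : ℤ) : ℤ) : ℝ) / t ^ ((q : ℕ) ^ ℓ)) p = 0 →
      ℓ + 1 ≤ p.natDegree := by
  intro p hp0 hp
  have hℓ0 : ℓ ≠ 0 := by lia
  by_contra! hdeg
  obtain ⟨B, hB, hpos⟩ := Polynomial.exists_forall_eval_natCast_pos hf
  obtain ⟨r, hr⟩ := exists_rat_add_tsum_primes_ge f ht hℓ0 B
  have ht0 : (0 : ℝ) < t := by positivity
  have hev := (evaluatesTo_primePowSeries f hℓ0 B (inv_pos.mpr ht0)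
    (inv_lt_one_of_one_lt₀ (by exact_mod_cast ht))).2
  rw [hr] at hp
  set s : ℝ := ∑' q : {p : ℕ // p.Prime ∧ B ≤ p},
    ((f.eval ((q : ℕ) : ℤ) : ℤ) : ℝ) * (t : ℝ)⁻¹ ^ ((q : ℕ) ^ ℓ)
  set g : ℚ[X] := p.comp (X + C r) with hg
  have hgs : Polynomial.aeval s g = 0 := by
    rw [hg, Polynomial.aeval_comp]
    simpa [add_comm] using hp
  have hg0 : g ≠ 0 := by
    intro h
    rw [hg, Polynomial.comp_eq_zero_iff] at h
    rcases h with h | ⟨-, h⟩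
    · exact hp0 h
    · have := congrArg Polynomial.natDegree h
      rw [Polynomial.natDegree_X_add_C, Polynomial.natDegree_C] at this
      lia
  have hgdeg : g.natDegree = p.natDegree := by
    rw [hg, Polynomial.natDegree_comp, Polynomial.natDegree_X_add_C, mul_one]
  set P : ℤ[X] := IsLocalization.integerNormalization (nonZeroDivisors ℤ) g
  have hP0 : P ≠ 0 := mt (IsLocalization.integerNormalization_eq_zero_iff le_rfl g).mp hg0
  have hPdeg : P.natDegree ≤ g.natDegree :=
    Polynomial.natDegree_le_natDegree (Polynomial.degree_mono
      (IsLocalization.integerNormalization_support _ g))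
  refine hP0 (hev.eq_zero_of_aeval_eq_zero ht (coeff_primePowSeries_nonneg hℓ0 hpos)
    (K := (4 * B) ^ ℓ) (ℓ := ℓ) (fun x ↦ ?_) (fun K N₀ ↦ ?_) (by lia)
    (IsLocalization.integerNormalization_aeval_eq_zero _ g hgs))
  · obtain ⟨q, hq, hBq, h1, h2⟩ := exists_prime_pow_between hB hℓ0 x
    refine ⟨q ^ ℓ, h1, h2, ?_⟩
    rw [coeff_primePowSeries_pow f hℓ0 hq hBq]
    exact (hpos q hBq).ne'
  · obtain ⟨M, hM, hle⟩ := exists_mul_log_mul_primeCounting_pow_le hℓ K N₀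
    refine ⟨M ^ ℓ, hM, le_trans ?_ hle⟩
    gcongr
    exact card_support_primePowSeries_le f hℓ0 B M
end

section
/- For integers t ≥ 2 and ℓ ≥ 1, if (a(n)) is a bounded sequence of nonnegative integers, nonzero for infinitely many n, and ∑_{n≥1} a(n)/t^n is algebraic of degree ℓ over ℚ, then #{m < n : a(m) ≠ 0} ≫ n^{1/ℓ}/(log n)^{1/ℓ} as n → ∞. -/
open Filter

theorem summable_succ_pow_div_two_pow (k : ℕ) :
    Summable fun n : ℕ => ((n : ℝ) + 1) ^ k / 2 ^ n := by
  have h := (summable_nat_add_iff 1).2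
    (summable_pow_mul_geometric_of_norm_lt_one (R := ℝ) k (r := 1 / 2) (by norm_num))
  refine (h.mul_left 2).congr fun n => ?_
  push_cast
  rw [pow_succ, one_div, inv_pow]
  field_simp

theorem abs_div_pow_le_of_polynomial_growth {t : ℕ} (ht : 2 ≤ t) {g : ℕ → ℝ} {M : ℝ} {k : ℕ}
    (hM : 0 ≤ M) (hg : ∀ n, |g n| ≤ M * ((n : ℝ) + 1) ^ k) (q n : ℕ) :
    |g (n + q) / (t : ℝ) ^ (n + q)| ≤
      M * ((q : ℝ) + 1) ^ k / (t : ℝ) ^ q * (((n : ℝ) + 1) ^ k / 2 ^ n) := by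
  have ht' : (2 : ℝ) ≤ t := by exact_mod_cast ht
  have ht0 : (0 : ℝ) < t := by linarith
  rw [abs_div, abs_of_pos (pow_pos ht0 _)]
  calc |g (n + q)| / (t : ℝ) ^ (n + q)
      ≤ (M * (((q : ℝ) + 1) * ((n : ℝ) + 1)) ^ k) / (2 ^ n * (t : ℝ) ^ q) := by
        have hpow : (2 : ℝ) ^ n * (t : ℝ) ^ q ≤ (t : ℝ) ^ (n + q) := by
          rw [pow_add]; gcongr
        refine div_le_div₀ (by positivity) ((hg _).trans ?_) (by positivity) hpow
        push_cast
        gcongr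
        nlinarith [mul_nonneg (Nat.cast_nonneg (α := ℝ) n) (Nat.cast_nonneg (α := ℝ) q)]
    _ = _ := by rw [mul_pow]; field_simp

theorem summable_div_pow_of_polynomial_growth {t : ℕ} (ht : 2 ≤ t) {g : ℕ → ℝ} {M : ℝ} {k : ℕ}
    (hM : 0 ≤ M) (hg : ∀ n, |g n| ≤ M * ((n : ℝ) + 1) ^ k) :
    Summable fun n => g n / (t : ℝ) ^ n :=
  Summable.of_norm_bounded ((summable_succ_pow_div_two_pow k).mul_left _) fun n => by
    rw [Real.norm_eq_abs]
    exact abs_div_pow_le_of_polynomial_growth ht hM hg 0 n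

theorem exists_abs_tsum_sub_sum_range_le {t : ℕ} (ht : 2 ≤ t) {g : ℕ → ℝ} {M : ℝ} {k : ℕ}
    (hM : 0 ≤ M) (hg : ∀ n, |g n| ≤ M * ((n : ℝ) + 1) ^ k) :
    ∃ A : ℕ, ∀ q : ℕ, |(∑' n, g n / (t : ℝ) ^ n) - ∑ n ∈ Finset.range q, g n / (t : ℝ) ^ n| ≤
      A * ((q : ℝ) + 1) ^ k / (t : ℝ) ^ q := by
  obtain ⟨A, hA⟩ := exists_nat_ge (M * ∑' n : ℕ, ((n : ℝ) + 1) ^ k / 2 ^ n)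
  refine ⟨A, fun q => ?_⟩
  rw [← (summable_div_pow_of_polynomial_growth ht hM hg).sum_add_tsum_nat_add q,
    add_sub_cancel_left, ← Real.norm_eq_abs]
  refine (tsum_of_norm_bounded ((summable_succ_pow_div_two_pow k).hasSum.mul_left _)
    (abs_div_pow_le_of_polynomial_growth ht hM hg q)).trans ?_
  calc M * ((q : ℝ) + 1) ^ k / (t : ℝ) ^ q * ∑' n : ℕ, ((n : ℝ) + 1) ^ k / 2 ^ n
      = (M * ∑' n : ℕ, ((n : ℝ) + 1) ^ k / 2 ^ n) * ((q : ℝ) + 1) ^ k / (t : ℝ) ^ q := by ring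
    _ ≤ _ := by gcongr

/-- If the partial sums `∑ n < q, g n / t ^ n` decay like `t ^ (-q)` up to a polynomial factor, then
`g` has no zero run of length `W` starting in a stretch where it is nonnegative and followed by a
positive value: the partial sum before the run, times `t ^ q`, would be an integer in `(-1, 0)`. -/
theorem exists_ne_zero_of_abs_sum_range_le {t : ℕ} (ht : 2 ≤ t) {g : ℕ → ℤ} {k A W N p q v : ℕ}
    (hA : ∀ q : ℕ, |∑ n ∈ Finset.range q, (g n : ℝ) / (t : ℝ) ^ n| ≤
      A * ((q : ℝ) + 1) ^ k / (t : ℝ) ^ q)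
    (hW : A * (N + 1) ^ k < 2 ^ W) (hv : v ≤ N) (hqp : q ≤ p) (hpv : p + W ≤ v)
    (hnonneg : ∀ n, q ≤ n → n < v → 0 ≤ g n) (hp : 1 ≤ g p) (hpv' : p < v) :
    ∃ n, q ≤ n ∧ n < q + W ∧ g n ≠ 0 := by
  have ht' : (2 : ℝ) ≤ t := by exact_mod_cast ht
  have ht0 : (0 : ℝ) < t := by linarith
  set s : ℕ → ℝ := fun q => ∑ n ∈ Finset.range q, (g n : ℝ) / (t : ℝ) ^ n with hs
  have hWt : (A : ℝ) * ((N : ℝ) + 1) ^ k < (t : ℝ) ^ W := by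
    calc (A : ℝ) * ((N : ℝ) + 1) ^ k < (2 : ℝ) ^ W := by exact_mod_cast hW
      _ ≤ _ := by gcongr
  have hbound : ∀ m : ℕ, m + W ≤ N → |s (m + W)| < 1 / (t : ℝ) ^ m := by
    intro m hm
    refine (hA _).trans_lt ?_
    rw [div_lt_div_iff₀ (by positivity) (by positivity), pow_add, one_mul, mul_comm]
    gcongr
    refine lt_of_le_of_lt ?_ hWt
    have : ((m + W : ℕ) : ℝ) ≤ N := by exact_mod_cast hm
    gcongr
  have hpos : s q < 0 := by
    have h1 : s q + 1 / (t : ℝ) ^ p ≤ s v := by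
      have h2 : s v = s q + ∑ n ∈ Finset.Ico q v, (g n : ℝ) / (t : ℝ) ^ n :=
        (Finset.sum_range_add_sum_Ico _ (by omega)).symm
      have h3 : (g p : ℝ) / (t : ℝ) ^ p ≤ ∑ n ∈ Finset.Ico q v, (g n : ℝ) / (t : ℝ) ^ n :=
        Finset.single_le_sum (f := fun n => (g n : ℝ) / (t : ℝ) ^ n) (fun n hn => by
          have := hnonneg n (Finset.mem_Ico.1 hn).1 (Finset.mem_Ico.1 hn).2
          have : (0 : ℝ) ≤ g n := by exact_mod_cast this
          positivity) (Finset.mem_Ico.2 ⟨hqp, hpv'⟩)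
      have h4 : 1 / (t : ℝ) ^ p ≤ (g p : ℝ) / (t : ℝ) ^ p := by
        gcongr; exact_mod_cast hp
      linarith
    have h5 := hbound (v - W) (by omega)
    rw [Nat.sub_add_cancel (by omega)] at h5
    have h6 : 1 / (t : ℝ) ^ (v - W) ≤ 1 / (t : ℝ) ^ p :=
      one_div_le_one_div_of_le (by positivity) (pow_le_pow_right₀ (by linarith) (by omega))
    have := (abs_lt.1 h5).2
    linarith
  by_contra! hzero
  have heq : s (q + W) = s q := by
    rw [hs]
    simp only
    rw [← Finset.sum_range_add_sum_Ico _ (Nat.le_add_right q W), add_eq_left]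
    refine Finset.sum_eq_zero fun n hn => ?_
    simp [hzero n (Finset.mem_Ico.1 hn).1 (Finset.mem_Ico.1 hn).2]
  have hint : ∃ z : ℤ, s q * (t : ℝ) ^ q = z := by
    refine ⟨∑ n ∈ Finset.range q, g n * (t : ℤ) ^ (q - n), ?_⟩
    push_cast
    rw [hs, Finset.sum_mul]
    refine Finset.sum_congr rfl fun n hn => ?_
    have : (t : ℝ) ^ q = (t : ℝ) ^ (q - n) * (t : ℝ) ^ n := by
      rw [← pow_add, Nat.sub_add_cancel (Finset.mem_range.1 hn).le]
    rw [this]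
    field_simp
  obtain ⟨z, hz⟩ := hint
  have h7 := (abs_lt.1 (hbound q (by omega))).1
  rw [heq, neg_lt, lt_div_iff₀ (by positivity)] at h7
  have h8 : s q * (t : ℝ) ^ q < 0 := mul_neg_of_neg_of_pos hpos (by positivity)
  have h9 : z < 0 := by rw [hz] at h8; exact_mod_cast h8
  have h10 : -1 < z := by
    have : (-1 : ℝ) < z := by linarith
    exact_mod_cast this
  omega

theorem le_mul_card_filter_range (U V : ℕ → Prop) [DecidablePred U] [DecidablePred V] {w N : ℕ}
    (hU : U 0)
    (h : ∀ u v, U u → u < v → v ≤ N → (∀ n, u < n → n < v → ¬ U n) →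
      v - u ≤ w * ((Finset.Ico u v).filter V).card) {v : ℕ} (hv : v ≤ N) :
    v ≤ w * ((Finset.range v).filter V).card := by
  induction v using Nat.strong_induction_on with
  | _ v ih =>
    rcases Nat.eq_zero_or_pos v with rfl | hv0
    · simp
    set u := Nat.findGreatest U (v - 1) with hu
    have huv : u < v := by have := Nat.findGreatest_le (P := U) (v - 1); omega
    have hUu : U u := Nat.findGreatest_spec (Nat.zero_le _) hU
    have h1 := ih u huv (by omega)
    have h2 := h u v hUu huv hv fun n hn hnv => Nat.findGreatest_is_greatest hn (by omega)
    have h3 : ((Finset.range v).filter V).card =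
        ((Finset.range u).filter V).card + ((Finset.Ico u v).filter V).card := by
      rw [← Finset.card_union_of_disjoint, ← Finset.filter_union, Finset.range_eq_Ico,
        Finset.range_eq_Ico, Finset.Ico_union_Ico_eq_Ico (Nat.zero_le _) huv.le]
      refine Finset.disjoint_filter_filter ?_
      rw [Finset.range_eq_Ico]
      exact Finset.Ico_disjoint_Ico_consecutive 0 u v
    rw [h3, mul_add]
    omega

theorem sub_le_mul_card_filter_Ico (V : ℕ → Prop) [DecidablePred V] {u p v W : ℕ}
    (hpv : p + W ≤ v)
    (h : ∀ q, u < q → q ≤ p → ∃ n, q ≤ n ∧ n < q + W ∧ V n) :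
    p - u ≤ W * ((Finset.Ico u v).filter V).card := by
  have hsub : Finset.Ioc u p ⊆
      ((Finset.Ico u v).filter V).biUnion fun n => Finset.Ioc (n - W) n := by
    intro q hq
    rw [Finset.mem_Ioc] at hq
    obtain ⟨n, hqn, hnq, hn⟩ := h q hq.1 hq.2
    simp only [Finset.mem_biUnion, Finset.mem_filter, Finset.mem_Ico, Finset.mem_Ioc]
    exact ⟨n, ⟨⟨by omega, by omega⟩, hn⟩, by omega, hqn⟩
  rw [← Nat.card_Ioc, mul_comm]
  refine (Finset.card_le_card hsub).trans (Finset.card_biUnion_le_card_mul _ _ _ fun n _ => ?_)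
  rw [Nat.card_Ioc]
  omega

/-- If the coefficients `g n` of a vanishing series `∑ g n / t ^ n` are nonnegative off `U`, and are
positive at the sum of an element of `U` and one of `S` whenever that sum is not in `U`, then the
support of `g` has logarithmically bounded average gaps. -/
theorem le_mul_card_of_abs_sum_range_le {t : ℕ} (ht : 2 ≤ t) {g : ℕ → ℤ} {k A W N c : ℕ}
    (U V S : ℕ → Prop) [DecidablePred U] [DecidablePred V]
    (hA : ∀ q : ℕ, |∑ n ∈ Finset.range q, (g n : ℝ) / (t : ℝ) ^ n| ≤
      A * ((q : ℝ) + 1) ^ k / (t : ℝ) ^ q)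
    (hW : A * (N + 1) ^ k < 2 ^ W) (hW1 : 1 ≤ W) (hc1 : 1 ≤ c) (hU0 : U 0)
    (hUV : ∀ n, U n → V n) (hgV : ∀ n, g n ≠ 0 → V n) (hgU : ∀ n, ¬ U n → 0 ≤ g n)
    (hgS : ∀ n s, U n → S s → ¬ U (n + s) → 1 ≤ g (n + s))
    (hS : ∀ y, ∃ s, S s ∧ y < s ∧ s ≤ c * (y + 1)) :
    N ≤ 4 * c * W * ((Finset.range N).filter V).card := by
  refine le_mul_card_filter_range U V hU0 (fun u v hu huv hvN hfree => ?_) le_rfl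
  have hcard : 1 ≤ ((Finset.Ico u v).filter V).card :=
    Finset.card_pos.2 ⟨u, by simp [huv, hUV u hu]⟩
  rcases le_or_gt (v - u) (4 * c * W) with hsmall | hlarge
  · exact hsmall.trans (Nat.le_mul_of_pos_right _ hcard)
  set L := v - u with hL
  obtain ⟨s, hs, hys, hsy⟩ := hS (L / (2 * c) - 1)
  have hdiv : 1 ≤ L / (2 * c) := by
    rw [Nat.one_le_div_iff (by omega)]
    nlinarith
  rw [Nat.sub_add_cancel hdiv] at hsy
  have hdivL : 2 * c * (L / (2 * c)) ≤ L := Nat.mul_div_le _ _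
  have hLdiv : L < 2 * c * (L / (2 * c) + 1) := Nat.lt_mul_div_succ _ (by omega)
  have h2s : 2 * s ≤ L := by nlinarith
  have hs1 : L / (2 * c) ≤ s := by omega
  have h2W : 2 * W ≤ L := by nlinarith
  have hdense := sub_le_mul_card_filter_Ico V (u := u) (p := u + s) (v := v) (W := W) (by omega)
    fun q huq hqp => by
      obtain ⟨n, h1, h2, h3⟩ := exists_ne_zero_of_abs_sum_range_le ht hA hW hvN hqp (by omega)
        (fun n hqn hnv => hgU n (hfree n (by omega) hnv))
        (hgS u s hu hs (hfree _ (by omega) (by omega))) (by omega)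
      exact ⟨n, h1, h2, hgV n h3⟩
  rw [Nat.add_sub_cancel_left] at hdense
  calc L ≤ 4 * c * s := by nlinarith
    _ ≤ 4 * c * (W * ((Finset.Ico u v).filter V).card) := by gcongr
    _ = _ := by ring

open PowerSeries in
theorem coeff_mk_pow_le_s12 {b : ℕ → ℕ} {C : ℕ} (hb : ∀ n, b n ≤ C) (d n : ℕ) :
    coeff n (mk b ^ d) ≤ C ^ d * (n + 1) ^ d := by
  induction d generalizing n with
  | zero => rw [pow_zero, coeff_one]; split_ifs <;> simp
  | succ d ih =>
    rw [pow_succ, coeff_mul]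
    calc ∑ p ∈ Finset.HasAntidiagonal.antidiagonal n, coeff p.1 (mk b ^ d) * coeff p.2 (mk b)
        ≤ ∑ p ∈ Finset.HasAntidiagonal.antidiagonal n, C ^ d * (n + 1) ^ d * C := by
          refine Finset.sum_le_sum fun p hp => ?_
          have hp' : p.1 ≤ n := by have := Finset.HasAntidiagonal.mem_antidiagonal.1 hp; omega
          rw [coeff_mk]
          gcongr
          · exact (ih _).trans (by gcongr)
          · exact hb _
      _ = _ := by
          rw [Finset.sum_const, Finset.Nat.card_antidiagonal, smul_eq_mul]; ring

open PowerSeries in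
theorem hasSum_coeff_mk_pow_s12 {t : ℕ} (ht : 2 ≤ t) {b : ℕ → ℕ} {C : ℕ} (hb : ∀ n, b n ≤ C) (d : ℕ) :
    HasSum (fun n => ((coeff n (mk b ^ d) : ℕ) : ℝ) / (t : ℝ) ^ n)
      ((∑' n, (b n : ℝ) / (t : ℝ) ^ n) ^ d) := by
  have ht0 : (t : ℝ) ≠ 0 := by positivity
  have hsum : ∀ d, Summable fun n => ((coeff n (mk b ^ d) : ℕ) : ℝ) / (t : ℝ) ^ n := fun d =>
    summable_div_pow_of_polynomial_growth ht (M := (C : ℝ) ^ d) (k := d) (by positivity)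
      fun n => by
        rw [abs_of_nonneg (by positivity)]
        exact_mod_cast coeff_mk_pow_le_s12 hb d n
  have hnorm : ∀ d, Summable fun n => ‖((coeff n (mk b ^ d) : ℕ) : ℝ) / (t : ℝ) ^ n‖ := fun d =>
    (hsum d).norm
  suffices h : ∑' n, ((coeff n (mk b ^ d) : ℕ) : ℝ) / (t : ℝ) ^ n =
      (∑' n, (b n : ℝ) / (t : ℝ) ^ n) ^ d from h ▸ (hsum d).hasSum
  induction d with
  | zero =>
    rw [tsum_eq_single 0 fun n hn => by simp [coeff_one, hn]]
    simp
  | succ d ih =>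
    have h1 := hnorm 1
    simp only [pow_one, coeff_mk] at h1
    rw [pow_succ (∑' n, _), ← ih, tsum_mul_tsum_eq_tsum_sum_antidiagonal_of_summable_norm (hnorm d) h1]
    refine tsum_congr fun n => ?_
    rw [pow_succ, coeff_mul]
    push_cast
    rw [Finset.sum_div]
    refine Finset.sum_congr rfl fun p hp => ?_
    rw [coeff_mk, div_mul_div_comm, ← pow_add, Finset.HasAntidiagonal.mem_antidiagonal.1 hp]

open PowerSeries in
theorem coeff_mk_pow_mul_le (b : ℕ → ℕ) (d m n : ℕ) :
    coeff m (mk b ^ d) * b n ≤ coeff (m + n) (mk b ^ (d + 1)) := by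
  rw [pow_succ, coeff_mul]
  refine le_trans ?_ (Finset.single_le_sum (fun _ _ => Nat.zero_le _)
    (Finset.HasAntidiagonal.mem_antidiagonal.2 (rfl : (m, n).1 + (m, n).2 = m + n)))
  rw [coeff_mk]

open PowerSeries in
theorem coeff_mk_pow_mono {b : ℕ → ℕ} (hb0 : b 0 = 1) (n : ℕ) :
    Monotone fun d => coeff n (mk b ^ d) :=
  monotone_nat_of_le_succ fun d => by simpa [hb0] using coeff_mk_pow_mul_le b d n 0

open PowerSeries in
theorem card_filter_coeff_mk_pow_le (b : ℕ → ℕ) (N d : ℕ) :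
    ((Finset.range N).filter fun n => coeff n (mk b ^ d) ≠ 0).card ≤
      ((Finset.range N).filter fun n => b n ≠ 0).card ^ d := by
  induction d with
  | zero =>
    rw [pow_zero (Finset.card _), Finset.card_le_one]
    intro x hx y hy
    simp only [pow_zero, coeff_one, Finset.mem_filter] at hx hy
    grind
  | succ d ih =>
    refine le_trans ?_ (Nat.mul_le_mul_right _ ih)
    rw [← Finset.card_product]
    refine le_trans (Finset.card_le_card ?_) (Finset.card_image_le (f := fun p => p.1 + p.2))
    intro n hn
    simp only [Finset.mem_filter, Finset.mem_range] at hn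
    obtain ⟨hnN, hn⟩ := hn
    rw [pow_succ, coeff_mul] at hn
    obtain ⟨p, hp, hp0⟩ := Finset.exists_ne_zero_of_sum_ne_zero hn
    rw [coeff_mk] at hp0
    have hpn := Finset.HasAntidiagonal.mem_antidiagonal.1 hp
    simp only [Finset.mem_image, Finset.mem_product, Finset.mem_filter, Finset.mem_range]
    exact ⟨p, ⟨⟨by omega, left_ne_zero_of_mul hp0⟩, by omega, right_ne_zero_of_mul hp0⟩, hpn⟩

/-- A Liouville-type bound on the gaps between nonzero digits of an algebraic number. -/
theorem exists_digit_ne_zero_le {t : ℕ} (ht : 2 ≤ t) {b : ℕ → ℕ} {C : ℕ} (hb : ∀ n, b n ≤ C)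
    (hinf : ∀ y, ∃ n, y < n ∧ b n ≠ 0) {f : Polynomial ℤ} (hf : f ≠ 0)
    (hroot : Polynomial.aeval (∑' n, (b n : ℝ) / (t : ℝ) ^ n) f = 0) :
    ∃ c : ℕ, 1 ≤ c ∧ ∀ y, ∃ s, b s ≠ 0 ∧ y < s ∧ s ≤ c * (y + 1) := by
  have ht' : (2 : ℝ) ≤ t := by exact_mod_cast ht
  have ht0 : (0 : ℝ) < t := by linarith
  set Y := ∑' n, (b n : ℝ) / (t : ℝ) ^ n with hY
  set s : ℕ → ℝ := fun q => ∑ n ∈ Finset.range q, (b n : ℝ) / (t : ℝ) ^ n with hs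
  have hg : ∀ n, |(b n : ℝ)| ≤ (C : ℝ) * ((n : ℝ) + 1) ^ 0 := fun n => by
    rw [abs_of_nonneg (by positivity), pow_zero, mul_one]
    exact_mod_cast hb n
  have hsummable := summable_div_pow_of_polynomial_growth ht (Nat.cast_nonneg C) hg
  obtain ⟨A, hA⟩ := exists_abs_tsum_sub_sum_range_le ht (Nat.cast_nonneg C) hg
  simp only [pow_zero, mul_one] at hA
  have htendsto : Tendsto s atTop (nhds Y) := hsummable.hasSum.tendsto_sum_nat
  have hlt : ∀ q, s q ≠ Y := by
    intro q
    obtain ⟨n, hn, hbn⟩ := hinf q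
    refine ne_of_lt ?_
    refine lt_of_lt_of_le (b := s (n + 1)) ?_
      (hsummable.sum_le_tsum _ fun _ _ => by positivity)
    refine Finset.sum_lt_sum_of_subset (i := n) ?_ ?_ ?_ ?_ ?_
    · exact Finset.range_subset_range.2 (by omega)
    · simp
    · simp; omega
    · have : 0 < b n := Nat.pos_of_ne_zero hbn
      positivity
    · intros; positivity
  have hne : ∀ᶠ q in atTop, Polynomial.aeval (s q) f ≠ 0 := by
    have hfin : ((f.rootSet ℝ) \ {Y}).Finite := (f.rootSet_finite ℝ).subset Set.sdiff_subset
    filter_upwards [htendsto.eventually (hfin.isClosed.isOpen_compl.mem_nhds (by simp))] with q hq h0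
    exact hq ⟨Polynomial.mem_rootSet.2 ⟨hf, h0⟩, hlt q⟩
  obtain ⟨K, hK⟩ := (((f.map (algebraMap ℤ ℝ)).hasDerivAt Y).isBigO_sub.comp_tendsto
    htendsto).bound
  simp only [Function.comp_def, Polynomial.eval_map_algebraMap, hroot, sub_zero,
    Real.norm_eq_abs] at hK
  obtain ⟨y₀, hy₀⟩ := eventually_atTop.1 (hne.and hK)
  obtain ⟨e, he⟩ := exists_nat_ge (K * A)
  set ℓ := f.natDegree with hℓ
  have hkey : ∀ y, y₀ ≤ y → ∃ s, b s ≠ 0 ∧ y ≤ s ∧ s < ℓ * y + y + e + 1 := by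
    intro y hy
    by_contra! hzero
    set z := ℓ * y + y + e + 1 with hz
    have hsyz : s z = s y := by
      rw [hs]
      simp only
      rw [← Finset.sum_range_add_sum_Ico _ (show y ≤ z by omega), add_eq_left]
      refine Finset.sum_eq_zero fun n hn => ?_
      have : b n = 0 := by
        by_contra hbn
        have := hzero n hbn (Finset.mem_Ico.1 hn).1
        have := (Finset.mem_Ico.1 hn).2
        omega
      simp [this]
    have h1 : |s y - Y| ≤ A / (t : ℝ) ^ z := by
      rw [← hsyz, abs_sub_comm]; exact hA z
    obtain ⟨hne', hle⟩ := hy₀ y hy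
    have hrat : ∃ a : ℤ, s y = (a : ℝ) / ((t : ℤ) ^ y : ℤ) := by
      refine ⟨∑ n ∈ Finset.range y, (b n : ℤ) * (t : ℤ) ^ (y - n), ?_⟩
      rw [hs]
      push_cast
      rw [Finset.sum_div]
      refine Finset.sum_congr rfl fun n hn => ?_
      have : (t : ℝ) ^ y = (t : ℝ) ^ (y - n) * (t : ℝ) ^ n := by
        rw [← pow_add, Nat.sub_add_cancel (Finset.mem_range.1 hn).le]
      rw [this]
      field_simp
    obtain ⟨a, ha⟩ := hrat
    have hlow := one_le_pow_mul_abs_eval_div (K := ℝ) (f := f) (a := a) (b := (t : ℤ) ^ y)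
      (by positivity) (by rwa [← ha, Polynomial.eval_map_algebraMap])
    rw [← ha, Polynomial.eval_map_algebraMap] at hlow
    push_cast at hlow
    have hK0 : 0 ≤ K := by
      by_contra! hK0
      have := abs_pos.2 hne'
      nlinarith [abs_nonneg (s y - Y)]
    have h2 : (1 : ℝ) ≤ ((t : ℝ) ^ y) ^ ℓ * (e / (t : ℝ) ^ z) := by
      refine hlow.trans ?_
      gcongr
      calc _ ≤ K * |s y - Y| := hle
        _ ≤ K * (A / (t : ℝ) ^ z) := by gcongr
        _ = K * A / (t : ℝ) ^ z := by ring
        _ ≤ _ := by gcongr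
    have h3 : (e : ℝ) < (t : ℝ) ^ (y + e + 1) := by
      calc (e : ℝ) < (t : ℝ) ^ e := by exact_mod_cast Nat.lt_pow_self (by omega)
        _ ≤ _ := pow_le_pow_right₀ (by linarith) (by omega)
    rw [hz, show ℓ * y + y + e + 1 = y * ℓ + (y + e + 1) by ring, pow_add, ← pow_mul,
      ← mul_div_assoc, mul_div_mul_left _ _ (by positivity), le_div_iff₀ (by positivity)] at h2
    linarith
  refine ⟨(ℓ + 1) * (y₀ + 1) + e + 1, by omega, fun y => ?_⟩
  obtain ⟨s, h1, h2, h3⟩ := hkey (y₀ + y + 1) (by omega)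
  refine ⟨s, h1, by omega, ?_⟩
  nlinarith [Nat.zero_le (ℓ * y₀ * y), Nat.zero_le (y₀ * y), Nat.zero_le (e * y), Nat.zero_le (ℓ * y)]

open PowerSeries in
theorem exists_le_mul_card_digits_pow {t : ℕ} (ht : 2 ≤ t) {b : ℕ → ℕ} {C : ℕ} (hb : ∀ n, b n ≤ C)
    (hb0 : b 0 = 1) (hinf : ∀ y, ∃ n, y < n ∧ b n ≠ 0) {f : Polynomial ℤ}
    (hdeg : 1 ≤ f.natDegree) (hlead : 0 < f.leadingCoeff)
    (hroot : Polynomial.aeval (∑' n, (b n : ℝ) / (t : ℝ) ^ n) f = 0) :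
    ∃ A c : ℕ, 1 ≤ c ∧ ∀ N W : ℕ, 1 ≤ W → A * (N + 1) ^ f.natDegree < 2 ^ W →
      N ≤ 4 * c * W * ((Finset.range N).filter fun n => b n ≠ 0).card ^ f.natDegree := by
  obtain ⟨m, hm⟩ : ∃ m, f.natDegree = m + 1 := ⟨f.natDegree - 1, by omega⟩
  have hC : 1 ≤ C := hb0 ▸ hb 0
  set g : ℕ → ℤ := fun n =>
    ∑ d ∈ Finset.range (f.natDegree + 1), f.coeff d * (coeff n (mk b ^ d) : ℕ) with hg
  have hsum : HasSum (fun n => (g n : ℝ) / (t : ℝ) ^ n) 0 := by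
    rw [← hroot, Polynomial.aeval_eq_sum_range]
    have := hasSum_sum (s := Finset.range (f.natDegree + 1)) fun d _ =>
      (hasSum_coeff_mk_pow_s12 ht hb d).mul_left (f.coeff d : ℝ)
    simp only [zsmul_eq_mul]
    refine this.congr_fun fun n => ?_
    rw [hg]
    push_cast
    rw [Finset.sum_div]
    simp only [mul_div_assoc]
  have hbound : ∀ n, |(g n : ℝ)| ≤
      (∑ d ∈ Finset.range (f.natDegree + 1), |(f.coeff d : ℝ)| * (C : ℝ) ^ d) *
        ((n : ℝ) + 1) ^ f.natDegree := by
    intro n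
    rw [hg]
    push_cast
    rw [Finset.sum_mul]
    refine (Finset.abs_sum_le_sum_abs _ _).trans (Finset.sum_le_sum fun d hd => ?_)
    rw [abs_mul, mul_assoc, Nat.abs_cast]
    gcongr
    calc ((coeff n (mk b ^ d) : ℕ) : ℝ) ≤ (C : ℝ) ^ d * ((n : ℝ) + 1) ^ d := by
          exact_mod_cast coeff_mk_pow_le_s12 hb d n
      _ ≤ _ := by
          gcongr
          · linarith [Nat.cast_nonneg (α := ℝ) n]
          · exact Nat.lt_succ_iff.1 (Finset.mem_range.1 hd)
  obtain ⟨A, hA⟩ := exists_abs_tsum_sub_sum_range_le ht (by positivity) hbound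
  simp only [hsum.tsum_eq, zero_sub, abs_neg] at hA
  obtain ⟨c, hc1, hc⟩ := exists_digit_ne_zero_le ht hb hinf
    (Polynomial.leadingCoeff_ne_zero.1 hlead.ne') hroot
  have hmono := coeff_mk_pow_mono hb0
  have hgtop : ∀ n, coeff n (mk b ^ m) = 0 →
      g n = f.leadingCoeff * (coeff n (mk b ^ f.natDegree) : ℕ) := by
    intro n hn
    rw [hg]
    simp only
    rw [Finset.sum_range_succ, add_eq_right.2, Polynomial.leadingCoeff]
    refine Finset.sum_eq_zero fun d hd => ?_
    have hdm : d ≤ m := by have := Finset.mem_range.1 hd; omega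
    have : coeff n (mk b ^ d) = 0 := Nat.le_zero.1 (hn ▸ hmono n hdm)
    simp [this]
  refine ⟨A, c, hc1, fun N W hW1 hW => ?_⟩
  refine (le_mul_card_of_abs_sum_range_le ht (fun n => coeff n (mk b ^ m) ≠ 0)
    (fun n => coeff n (mk b ^ f.natDegree) ≠ 0) (fun n => b n ≠ 0) hA hW hW1 hc1 ?_ ?_ ?_ ?_ ?_
    hc).trans (Nat.mul_le_mul_left _ (card_filter_coeff_mk_pow_le b N _))
  · have := hmono 0 (Nat.zero_le m)
    simp only [pow_zero, coeff_zero_one] at this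
    omega
  · intro n hn
    have := hmono n (show m ≤ f.natDegree by omega)
    simp only at this
    omega
  · intro n hn hn0
    refine hn (Finset.sum_eq_zero fun d hd => ?_)
    have hd' : d ≤ f.natDegree := Nat.lt_succ_iff.1 (Finset.mem_range.1 hd)
    have : coeff n (mk b ^ d) = 0 := Nat.le_zero.1 (hn0 ▸ hmono n hd')
    simp [this]
  · intro n hn
    rw [hgtop n (not_not.1 hn)]
    positivity
  · intro n s hn hs hns
    rw [hgtop _ (not_not.1 hns)]
    have h1 := coeff_mk_pow_mul_le b m n s
    rw [← hm] at h1
    have h2 : 0 < coeff (n + s) (mk b ^ f.natDegree) :=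
      (Nat.mul_pos (Nat.pos_of_ne_zero hn) (Nat.pos_of_ne_zero hs)).trans_le h1
    have h3 : (0 : ℤ) < (coeff (n + s) (mk b ^ f.natDegree) : ℕ) := by exact_mod_cast h2
    exact Int.add_one_le_of_lt (mul_pos hlead h3)

theorem exists_int_polynomial_aeval_one_add_eq_zero {x : ℝ} (hx : IsAlgebraic ℚ x) :
    ∃ f : Polynomial ℤ, f.natDegree = (minpoly ℚ x).natDegree ∧ 0 < f.leadingCoeff ∧
      Polynomial.aeval (1 + x) f = 0 := by
  set p := (minpoly ℚ x).comp (Polynomial.X - Polynomial.C 1) with hp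
  have hpdeg : p.natDegree = (minpoly ℚ x).natDegree := by
    rw [hp, Polynomial.natDegree_comp, Polynomial.natDegree_X_sub_C, mul_one]
  have hp0 : p ≠ 0 := fun h0 => by
    have := minpoly.natDegree_pos hx.isIntegral
    rw [← hpdeg, h0] at this
    simp at this
  have hproot : Polynomial.aeval (1 + x) p = 0 := by
    simp [hp, Polynomial.aeval_comp]
  set f := IsLocalization.integerNormalization (nonZeroDivisors ℤ) p with hf
  have hf0 : f ≠ 0 := mt IsFractionRing.integerNormalization_eq_zero_iff.1 hp0
  have hfroot : Polynomial.aeval (1 + x) f = 0 :=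
    IsLocalization.integerNormalization_aeval_eq_zero _ p hproot
  have hfdeg : f.natDegree = p.natDegree := by
    obtain ⟨d, hd, hfd⟩ := IsLocalization.integerNormalization_spec (nonZeroDivisors ℤ) p
    rw [← Polynomial.natDegree_map_eq_of_injective (algebraMap ℤ ℚ).injective_int, hfd]
    exact Polynomial.natDegree_smul_of_smul_regular _
      (IsSMulRegular.of_ne_zero (nonZeroDivisors.ne_zero hd))
  rcases lt_or_gt_of_ne (Polynomial.leadingCoeff_ne_zero.2 hf0) with h | h
  · refine ⟨-f, ?_, ?_, ?_⟩
    · rw [Polynomial.natDegree_neg, hfdeg, hpdeg]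
    · rw [Polynomial.leadingCoeff_neg]; omega
    · rw [map_neg, hfroot, neg_zero]
  · exact ⟨f, hfdeg.trans hpdeg, h, hfroot⟩

theorem eventually_exists_two_pow_gt (A ℓ : ℕ) :
    ∀ᶠ N : ℕ in atTop, ∃ W : ℕ, 1 ≤ W ∧ A * (N + 1) ^ ℓ < 2 ^ W ∧
      (W : ℝ) ≤ (4 * ℓ + 4) * Real.log N := by
  filter_upwards [eventually_ge_atTop (A + 2)] with N hN
  set B := (A + 1) * (N + 1) ^ ℓ with hB
  have hB0 : B ≠ 0 := by positivity
  have hBlt := Nat.lt_pow_succ_log_self one_lt_two B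
  refine ⟨Nat.log 2 B + 1, by omega, lt_of_le_of_lt (by rw [hB]; gcongr; omega) hBlt, ?_⟩
  have hN2 : (2 : ℝ) ≤ N := by exact_mod_cast (by omega : 2 ≤ N)
  have hAN : (A : ℝ) + 1 ≤ N := by exact_mod_cast (by omega : A + 1 ≤ N)
  have hlog2 : (1 : ℝ) / 2 < Real.log 2 := by linarith [Real.log_two_gt_d9]
  have hlogN : Real.log 2 ≤ Real.log N := Real.log_le_log (by norm_num) hN2
  have hlogA : Real.log ((A : ℝ) + 1) ≤ Real.log N := Real.log_le_log (by positivity) hAN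
  have hlogN1 : Real.log ((N : ℝ) + 1) ≤ 2 * Real.log N := by
    rw [← Real.log_rpow (by linarith)]
    refine Real.log_le_log (by positivity) ?_
    norm_cast
    nlinarith
  have hpow : ((2 : ℝ) ^ Nat.log 2 B) ≤ ((A : ℝ) + 1) * ((N : ℝ) + 1) ^ ℓ := by
    exact_mod_cast Nat.pow_log_le_self 2 hB0
  have h := Real.log_le_log (by positivity) hpow
  rw [Real.log_pow, Real.log_mul (by positivity) (by positivity), Real.log_pow] at h
  have hℓ : (ℓ : ℝ) * Real.log ((N : ℝ) + 1) ≤ ℓ * (2 * Real.log N) := by gcongr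
  have hW : (Nat.log 2 B : ℝ) * (1 / 2) ≤ Nat.log 2 B * Real.log 2 := by gcongr
  push_cast
  nlinarith

theorem stmt12 (t : ℕ) (ht : 2 ≤ t) (ℓ : ℕ) (hℓ : 1 ≤ ℓ)
    (a : ℕ → ℕ) (hbdd : ∃ C : ℕ, ∀ n, a n ≤ C)
    (hinf : {n : ℕ | 1 ≤ n ∧ a n ≠ 0}.Infinite)
    (halg : IsAlgebraic ℚ (∑' n : ℕ, (a (n + 1) : ℝ) / t ^ (n + 1)))
    (hdeg : (minpoly ℚ (∑' n : ℕ, (a (n + 1) : ℝ) / t ^ (n + 1))).natDegree = ℓ) :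
    ∃ c : ℝ, 0 < c ∧ ∀ᶠ n : ℕ in atTop,
      c * ((n : ℝ) ^ ((ℓ : ℝ)⁻¹) / (Real.log n) ^ ((ℓ : ℝ)⁻¹)) ≤
        (Nat.card {m : ℕ | 1 ≤ m ∧ m < n ∧ a m ≠ 0} : ℝ) := by
  obtain ⟨C, hC⟩ := hbdd
  set b : ℕ → ℕ := Function.update a 0 1 with hbdef
  have hb0 : b 0 = 1 := by simp [hbdef]
  have hbs : ∀ n, n ≠ 0 → b n = a n := fun n hn => by simp [hbdef, hn]
  have hb : ∀ n, b n ≤ C + 1 := by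
    intro n
    rcases eq_or_ne n 0 with rfl | hn
    · omega
    · rw [hbs n hn]; exact (hC n).trans (Nat.le_succ C)
  have hbinf : ∀ y, ∃ n, y < n ∧ b n ≠ 0 := by
    intro y
    obtain ⟨n, hn, hyn⟩ := hinf.exists_gt y
    exact ⟨n, hyn, by rw [hbs n (by omega)]; exact hn.2⟩
  have hbsum : ∑' n, (b n : ℝ) / (t : ℝ) ^ n =
      1 + ∑' n : ℕ, (a (n + 1) : ℝ) / (t : ℝ) ^ (n + 1) := by
    rw [(summable_div_pow_of_polynomial_growth ht (k := 0) (M := (C + 1 : ℕ)) (by positivity)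
      fun n => by rw [Nat.abs_cast, pow_zero, mul_one]; exact_mod_cast hb n).tsum_eq_zero_add]
    simp [hb0, hbs]
  obtain ⟨f, hfdeg, hlead, hroot⟩ := exists_int_polynomial_aeval_one_add_eq_zero halg
  rw [hdeg] at hfdeg
  rw [← hbsum] at hroot
  obtain ⟨A, c, hc1, hmain⟩ := exists_le_mul_card_digits_pow ht hb hb0 hbinf
    (hfdeg ▸ hℓ) hlead hroot
  rw [hfdeg] at hmain
  set D : ℝ := 4 * c * (4 * ℓ + 4) with hD
  have hc0 : (0 : ℝ) < c := by exact_mod_cast hc1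
  have hD0 : 0 < D := by positivity
  have hE0 : 0 < D ^ ((ℓ : ℝ)⁻¹) := Real.rpow_pos_of_pos hD0 _
  refine ⟨1 / (2 * D ^ ((ℓ : ℝ)⁻¹)), by positivity, ?_⟩
  obtain ⟨n₀, hn₀, -⟩ := hinf.exists_gt 0
  filter_upwards [eventually_exists_two_pow_gt A ℓ, eventually_ge_atTop (n₀ + 2)] with N hN hN2
  obtain ⟨W, hW1, hW, hWlog⟩ := hN
  set k := Nat.card {m : ℕ | 1 ≤ m ∧ m < N ∧ a m ≠ 0} with hk
  have hkcard : k = ((Finset.Ico 1 N).filter fun m => a m ≠ 0).card := by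
    rw [hk, Nat.card_coe_set_eq, ← Set.ncard_coe_finset]
    congr 1
    ext m
    simp [and_assoc]
  have hk1 : 1 ≤ k := by
    rw [hkcard]
    exact Finset.card_pos.2 ⟨n₀, by simp [hn₀.1, hn₀.2]; omega⟩
  have hK : ((Finset.range N).filter fun n => b n ≠ 0).card ≤ k + 1 := by
    rw [hkcard]
    refine (Finset.card_le_card ?_).trans (Finset.card_insert_le 0 _)
    intro n hn
    rw [Finset.mem_filter, Finset.mem_range] at hn
    rcases eq_or_ne n 0 with rfl | hn0
    · simp
    · rw [hbs n hn0] at hn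
      simp only [Finset.mem_insert, Finset.mem_filter, Finset.mem_Ico]
      exact Or.inr ⟨⟨by omega, hn.1⟩, hn.2⟩
  have hNle : (N : ℝ) ≤ D * Real.log N * (2 * k) ^ ℓ := by
    calc (N : ℝ) ≤ 4 * c * W * (2 * k) ^ ℓ := by
          exact_mod_cast (hmain N W hW1 hW).trans (by gcongr; omega)
      _ ≤ 4 * c * ((4 * ℓ + 4) * Real.log N) * (2 * k) ^ ℓ := by gcongr
      _ = _ := by rw [hD]; ring
  have hlog : 0 < Real.log N := Real.log_pos (by exact_mod_cast (by omega : 1 < N))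
  have hquot : (N : ℝ) / Real.log N ≤ D * (2 * k) ^ ℓ := by
    rw [div_le_iff₀ hlog]; linarith
  have hroot' := Real.rpow_le_rpow (by positivity) hquot (by positivity : (0 : ℝ) ≤ (ℓ : ℝ)⁻¹)
  rw [Real.mul_rpow hD0.le (by positivity), Real.pow_rpow_inv_natCast (by positivity) (by omega),
    Real.div_rpow (by positivity) hlog.le] at hroot'
  rw [one_div, inv_mul_le_iff₀ (by positivity)]
  linarith
end
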